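/- Let H > 0 and let (R_t)_{t∈[0,1]} be a Gaussian Riemann–Liouville process with Hurst parameter H having continuous sample paths. Then there exists K ∈ (0, ∞) such that lim_{ε↓0} ε^{1/H} · log P[ sup_{0≤t≤1} |R_t| ≤ ε ] = −K. -/

import Mathlib

open MeasureTheory ProbabilityTheory Filter Set
open scoped ENNReal NNReal Topology

/-- A semi-norm family: assigns to each closed bounded interval `[a,b]` a semi-norm
on real-valued functions (the value depends only on the restriction to `[a,b]`). -/
structure SemiNormFamily where
  N : ℝ → ℝ → (ℝ → ℝ) → ℝ
  nonneg : ∀ (a b : ℝ) (f : ℝ → ℝ), 0 ≤ N a b f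
  homog : ∀ (a b c : ℝ) (f : ℝ → ℝ), N a b (fun t => c * f t) = |c| * N a b f
  triangle : ∀ (a b : ℝ) (f g : ℝ → ℝ), N a b (fun t => f t + g t) ≤ N a b f + N a b g
  restrict : ∀ (a b : ℝ) (f g : ℝ → ℝ), (∀ t ∈ Set.Icc a b, f t = g t) → N a b f = N a b g

namespace SemiNormFamily

/-- Contractivity: `‖f‖_I ≤ ‖f‖_J` whenever `I ⊆ J`. -/
def Contractive (S : SemiNormFamily) : Prop :=
  ∀ (a b a' b' : ℝ) (f : ℝ → ℝ), a' ≤ a → b ≤ b' → S.N a b f ≤ S.N a' b' f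

/-- Translation invariance: `‖f‖_{I-c} = ‖f(·-c)‖_I`. -/
def TranslationInvariant (S : SemiNormFamily) : Prop :=
  ∀ (a b c : ℝ) (f : ℝ → ℝ), S.N (a - c) (b - c) f = S.N a b (fun t => f (t - c))

/-- β-self-similarity: `‖f(c·)‖_{I/c} = c^β ‖f‖_I` for `c > 0`. -/
def SelfSimilar (S : SemiNormFamily) (β : ℝ) : Prop :=
  ∀ (a b c : ℝ), 0 < c → ∀ f : ℝ → ℝ,
    S.N (a / c) (b / c) (fun t => f (c * t)) = c ^ β * S.N a b f

/-- p-superadditivity (`0 < p < ∞`). -/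
def SuperAdditive (S : SemiNormFamily) (p : ℝ) : Prop :=
  ∀ (a b c : ℝ) (f : ℝ → ℝ), a < b → b < c →
    S.N a b f ^ p + S.N b c f ^ p ≤ S.N a c f ^ p

/-- ∞-superadditivity. -/
def SuperAdditiveTop (S : SemiNormFamily) : Prop :=
  ∀ (a b c : ℝ) (f : ℝ → ℝ), a < b → b < c →
    max (S.N a b f) (S.N b c f) ≤ S.N a c f

/-- Upper (β,p)-semi-norm, `0 < p < ∞`. -/
def IsUpper (S : SemiNormFamily) (β p : ℝ) : Prop :=
  S.Contractive ∧ S.TranslationInvariant ∧ S.SelfSimilar β ∧ S.SuperAdditive p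

/-- Upper (β,∞)-semi-norm. -/
def IsUpperTop (S : SemiNormFamily) (β : ℝ) : Prop :=
  S.Contractive ∧ S.TranslationInvariant ∧ S.SelfSimilar β ∧ S.SuperAdditiveTop

end SemiNormFamily

/-- A Gaussian Riemann–Liouville process with Hurst parameter `H`: a centered Gaussian
process, vanishing at `0`, with covariance
`E[R_s R_t] = ∫_0^{min s t} (t-u)^{H-1/2} (s-u)^{H-1/2} du`. -/
structure IsGaussianRL {Ω : Type*} [MeasurableSpace Ω] (P : Measure Ω)
    (R : ℝ → Ω → ℝ) (H : ℝ) : Prop where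
  meas : ∀ t : ℝ, Measurable (R t)
  gaussian : ∀ (n : ℕ) (t c : Fin n → ℝ), (∀ i, 0 ≤ t i) →
    ∃ v : ℝ≥0, P.map (fun ω => ∑ i, c i * R (t i) ω) = gaussianReal 0 v
  zero : ∀ ω, R 0 ω = 0
  cov : ∀ s t : ℝ, 0 ≤ s → 0 ≤ t →
    ∫ ω, R s ω * R t ω ∂P
      = ∫ u in Set.Ioc (0:ℝ) (min s t), (t - u) ^ (H - 1/2) * (s - u) ^ (H - 1/2)

open MeasureTheory ProbabilityTheory Filter Set
open scoped ENNReal NNReal Topology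

theorem bm_compact {K L : Set ℝ} (hK : IsCompact K) (hL : IsCompact L) (hKn : K.Nonempty)
    (hLn : L.Nonempty) {C : Set ℝ} (hC : ∀ x ∈ K, ∀ y ∈ L, x + y ∈ C) :
    volume K + volume L ≤ volume C := by
  have ha := hK.sSup_mem hKn
  have hb := hL.sInf_mem hLn
  set a := sSup K
  set b := sInf L
  have h1 : volume ((fun x => x + b) '' K) = volume K := by
    rw [Set.image_add_right, measure_preimage_add_right]
  have h2 : volume ((fun x => a + x) '' L) = volume L := by
    rw [Set.image_add_left, measure_preimage_add]
  rw [← h1, ← h2, ← measure_union₀]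
  · apply measure_mono
    rintro z (⟨x, hx, rfl⟩ | ⟨y, hy, rfl⟩)
    · exact hC _ hx _ hb
    · exact hC _ ha _ hy
  · exact (hL.image (continuous_const_add a)).measurableSet.nullMeasurableSet
  · have : ((fun x => x + b) '' K) ∩ ((fun x => a + x) '' L) ⊆ {a + b} := by
      rintro z ⟨⟨x, hx, rfl⟩, ⟨y, hy, hxy⟩⟩
      have := le_csSup hK.bddAbove hx
      have := csInf_le hL.bddBelow hy
      simp only [mem_singleton_iff]
      simp only at hxy
      linarith
    exact measure_mono_null this (by simp)

theorem bm_meas {A B : Set ℝ} (hA : MeasurableSet A) (hB : MeasurableSet B) (hAn : A.Nonempty)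
    (hBn : B.Nonempty) {C : Set ℝ} (hC : ∀ x ∈ A, ∀ y ∈ B, x + y ∈ C) :
    volume A + volume B ≤ volume C := by
  by_contra! hcon
  obtain ⟨a, ha⟩ := hAn
  obtain ⟨b, hb⟩ := hBn
  by_cases hA0 : volume A = 0
  · rw [hA0, zero_add] at hcon
    refine absurd hcon (not_lt.2 ?_)
    have h2 : volume ((fun x => a + x) '' B) = volume B := by
      rw [Set.image_add_left, measure_preimage_add]
    rw [← h2]
    apply measure_mono
    rintro _ ⟨y, hy, rfl⟩
    exact hC _ ha _ hy
  by_cases hB0 : volume B = 0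
  · rw [hB0, add_zero] at hcon
    refine absurd hcon (not_lt.2 ?_)
    have h2 : volume ((fun x => x + b) '' A) = volume A := by
      rw [Set.image_add_right, measure_preimage_add_right]
    rw [← h2]
    apply measure_mono
    rintro _ ⟨y, hy, rfl⟩
    exact hC _ hy _ hb
  obtain ⟨r, hr, s, hs, hrs⟩ := ENNReal.exists_lt_add_of_lt_add hcon hA0 hB0
  obtain ⟨K, hKA, hK, hrK⟩ := hA.exists_lt_isCompact hr
  obtain ⟨L, hLB, hL, hsL⟩ := hB.exists_lt_isCompact hs
  have := bm_compact hK hL (nonempty_of_measure_ne_zero (ne_of_gt (lt_of_le_of_lt zero_le hrK)))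
    (nonempty_of_measure_ne_zero (ne_of_gt (lt_of_le_of_lt zero_le hsL)))
    (fun x hx y hy => hC x (hKA hx) y (hLB hy))
  exact absurd (hrs.trans (ENNReal.add_lt_add hrK hsL)) (not_lt.2 this)

open scoped Pointwise in
theorem bm_lam {l : ℝ} (h0 : 0 < l) (h1 : l < 1) {A B : Set ℝ} (hA : MeasurableSet A)
    (hB : MeasurableSet B) (hAn : A.Nonempty)
    (hBn : B.Nonempty) {C : Set ℝ} (hC : ∀ x ∈ A, ∀ y ∈ B, l * x + (1 - l) * y ∈ C) :
    ENNReal.ofReal l * volume A + ENNReal.ofReal (1 - l) * volume B ≤ volume C := by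
  have e1 : volume (l • A) = ENNReal.ofReal l * volume A := by
    rw [Measure.addHaar_smul]; simp [abs_of_pos h0]
  have e2 : volume ((1 - l) • B) = ENNReal.ofReal (1 - l) * volume B := by
    rw [Measure.addHaar_smul]; simp [abs_of_pos (sub_pos.2 h1)]
  rw [← e1, ← e2]
  apply bm_meas (hA.const_smul_of_ne_zero h0.ne') (hB.const_smul_of_ne_zero (sub_pos.2 h1).ne')
    (hAn.smul_set) (hBn.smul_set)
  rintro _ ⟨x, hx, rfl⟩ _ ⟨y, hy, rfl⟩
  exact hC x hx y hy

theorem pl_normalized {l : ℝ} (h0 : 0 < l) (h1 : l < 1) {F G K : ℝ → ℝ} (hF : Measurable F)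
    (hG : Measurable G) (hK : Measurable K) (F0 : ∀ x, 0 ≤ F x) (G0 : ∀ x, 0 ≤ G x)
    (K0 : ∀ x, 0 ≤ K x) (F1 : ∀ x, F x ≤ 1) (G1 : ∀ x, G x ≤ 1)
    (Fs : ∀ t < 1, ∃ x, t < F x) (Gs : ∀ t < 1, ∃ x, t < G x)
    (h : ∀ x y t, 0 < t → t < F x → t < G y → t < K (l * x + (1 - l) * y)) :
    ENNReal.ofReal l * (∫⁻ x, ENNReal.ofReal (F x)) + ENNReal.ofReal (1 - l) *
      (∫⁻ x, ENNReal.ofReal (G x)) ≤ ∫⁻ x, ENNReal.ofReal (K x) := by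
  rw [lintegral_eq_lintegral_meas_lt _ (ae_of_all _ F0) hF.aemeasurable,
    lintegral_eq_lintegral_meas_lt _ (ae_of_all _ G0) hG.aemeasurable,
    lintegral_eq_lintegral_meas_lt _ (ae_of_all _ K0) hK.aemeasurable]
  have anti : ∀ F : ℝ → ℝ, Measurable (fun t => volume {a | t < F a}) := by
    intro F
    apply Antitone.measurable
    intro s t hst
    apply measure_mono
    intro a (ha : t < F a)
    exact lt_of_le_of_lt hst ha
  rw [← lintegral_const_mul _ (anti F), ← lintegral_const_mul _ (anti G),
    ← lintegral_add_left ((anti F).const_mul _)]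
  apply setLIntegral_mono (anti K)
  intro t ht
  by_cases ht1 : t < 1
  · apply bm_lam h0 h1 (measurableSet_lt measurable_const hF) (measurableSet_lt measurable_const hG)
      (Fs t ht1) (Gs t ht1)
    intro x hx y hy
    exact h x y t ht hx hy
  · have e1 : {a | t < F a} = ∅ := by
      ext a; simp; linarith [F1 a]
    have e2 : {a | t < G a} = ∅ := by
      ext a; simp; linarith [G1 a]
    rw [e1, e2]; simp

def PL {E : Type*} [AddCommGroup E] [Module ℝ E] [MeasurableSpace E] (μ : Measure E) : Prop :=
  ∀ l : ℝ, 0 < l → l < 1 → ∀ f g h : E → ℝ≥0∞, Measurable f → Measurable g → Measurable h →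
    (∀ x, f x ≤ 1) → (∀ x, g x ≤ 1) →
    (∀ x y, f x ^ l * g y ^ (1 - l) ≤ h (l • x + (1 - l) • y)) →
    (∫⁻ x, f x ∂μ) ^ l * (∫⁻ x, g x ∂μ) ^ (1 - l) ≤ ∫⁻ x, h x ∂μ

theorem amgm {l : ℝ} (h0 : 0 < l) (h1 : l < 1) (u v : ℝ≥0∞) :
    u ^ l * v ^ (1 - l) ≤ ENNReal.ofReal l * u + ENNReal.ofReal (1 - l) * v := by
  have h1' : 0 < 1 - l := sub_pos.2 h1
  have hc : (1 / l).HolderConjugate (1 / (1 - l)) := by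
    rw [Real.holderConjugate_iff]
    refine ⟨by rw [lt_div_iff₀ h0]; linarith, by field_simp; ring⟩
  have := ENNReal.young_inequality (u ^ l) (v ^ (1 - l)) hc
  rw [← ENNReal.rpow_mul, ← ENNReal.rpow_mul] at this
  rw [mul_one_div_cancel h0.ne', mul_one_div_cancel h1'.ne', ENNReal.rpow_one, ENNReal.rpow_one] at this
  rw [one_div, one_div, ENNReal.ofReal_inv_of_pos h0, ENNReal.ofReal_inv_of_pos h1', div_eq_mul_inv,
    div_eq_mul_inv, inv_inv, inv_inv, mul_comm u, mul_comm v] at this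
  exact this

theorem pl_volume : PL (volume : Measure ℝ) := by
  intro l h0 h1 f g h hf hg hh f1 g1 hfg
  have h1' : 0 < 1 - l := sub_pos.2 h1
  set a := ⨆ x, f x with ha
  set b := ⨆ x, g x with hb
  have ha1 : a ≤ 1 := iSup_le f1
  have hb1 : b ≤ 1 := iSup_le g1
  have hat : a ≠ ⊤ := (ha1.trans_lt ENNReal.one_lt_top).ne
  have hbt : b ≠ ⊤ := (hb1.trans_lt ENNReal.one_lt_top).ne
  have hfa : ∀ x, f x ≤ a := fun x => le_iSup f x
  have hgb : ∀ x, g x ≤ b := fun x => le_iSup g x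
  by_cases ha0 : a = 0
  · have : ∀ x, f x = 0 := fun x => le_antisymm (ha0 ▸ hfa x) zero_le
    simp [this, ENNReal.zero_rpow_of_pos h0]
  by_cases hb0 : b = 0
  · have : ∀ x, g x = 0 := fun x => le_antisymm (hb0 ▸ hgb x) zero_le
    simp [this, ENNReal.zero_rpow_of_pos h1']
  set c := a ^ l * b ^ (1 - l) with hc
  have hc0 : c ≠ 0 := mul_ne_zero (by simp [ha0, hat]) (by simp [hb0, hbt])
  have hct : c ≠ ⊤ := ENNReal.mul_ne_top (by simp [ha0, hat]) (by simp [hb0, hbt])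
  have fa1 : ∀ x, f x / a ≤ 1 := fun x => ENNReal.div_le_of_le_mul (by simpa using hfa x)
  have ga1 : ∀ x, g x / b ≤ 1 := fun x => ENNReal.div_le_of_le_mul (by simpa using hgb x)
  have fat : ∀ x, f x / a ≠ ⊤ := fun x => ((fa1 x).trans_lt ENNReal.one_lt_top).ne
  have gat : ∀ x, g x / b ≠ ⊤ := fun x => ((ga1 x).trans_lt ENNReal.one_lt_top).ne
  have hh1 : ∀ x, min (h x / c) 1 ≠ ⊤ := fun x => ((min_le_right _ _).trans_lt ENNReal.one_lt_top).ne
  have sup_aux : ∀ (f : ℝ → ℝ≥0∞) (a : ℝ≥0∞), a = (⨆ x, f x) → a ≠ 0 → a ≠ ⊤ →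
      (∀ x, f x / a ≤ 1) → ∀ t < (1:ℝ), ∃ x, t < (f x / a).toReal := by
    intro f a ha ha0 hat fa1 t ht
    by_contra! hcon
    have hle : a ≤ ENNReal.ofReal t * a := by
      conv_lhs => rw [ha]
      apply iSup_le
      intro x
      have := hcon x
      have h2 : f x / a ≤ ENNReal.ofReal t := by
        rw [← ENNReal.ofReal_toReal ((fa1 x).trans_lt ENNReal.one_lt_top).ne]
        exact ENNReal.ofReal_le_ofReal this
      rwa [ENNReal.div_le_iff ha0 hat] at h2
    have h3 : ENNReal.ofReal t < 1 := by simpa using ht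
    have h4 : ENNReal.ofReal t * a < 1 * a := ENNReal.mul_lt_mul_left ha0 hat h3
    rw [one_mul] at h4
    exact absurd h4 (not_lt.2 hle)
  have key := pl_normalized h0 h1 (F := fun x => (f x / a).toReal) (G := fun x => (g x / b).toReal)
    (K := fun x => (min (h x / c) 1).toReal) (hf.div_const a).ennreal_toReal
    (hg.div_const b).ennreal_toReal ((hh.div_const c).min measurable_const).ennreal_toReal
    (fun x => ENNReal.toReal_nonneg) (fun x => ENNReal.toReal_nonneg)
    (fun x => ENNReal.toReal_nonneg)
    (fun x => by simpa using ENNReal.toReal_mono ENNReal.one_ne_top (fa1 x))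
    (fun x => by simpa using ENNReal.toReal_mono ENNReal.one_ne_top (ga1 x))
    (sup_aux f a ha ha0 hat fa1) (sup_aux g b hb hb0 hbt ga1) (by
      intro x y t ht htf htg
      have htf' : ENNReal.ofReal t < f x / a := (ENNReal.ofReal_lt_iff_lt_toReal ht.le (fat x)).2 htf
      have htg' : ENNReal.ofReal t < g y / b := (ENNReal.ofReal_lt_iff_lt_toReal ht.le (gat y)).2 htg
      rw [← ENNReal.ofReal_lt_iff_lt_toReal ht.le (hh1 _)]
      refine lt_min ?_ (htf'.trans_le (fa1 x))
      have e : (f x / a) ^ l * (g y / b) ^ (1 - l) ≤ h (l * x + (1 - l) * y) / c := by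
        rw [ENNReal.div_rpow_of_nonneg _ _ h0.le, ENNReal.div_rpow_of_nonneg _ _ h1'.le]
        rw [← ENNReal.mul_div_mul_comm (Or.inr (by simp [hb0, hbt])) (Or.inr (by simp [hb0, hbt]))]
        exact ENNReal.div_le_div_right (hfg x y) _
      refine lt_of_lt_of_le ?_ e
      have ht0 : ENNReal.ofReal t ≠ 0 := by simpa using ht
      calc ENNReal.ofReal t = ENNReal.ofReal t ^ l * ENNReal.ofReal t ^ (1 - l) := by
            rw [← ENNReal.rpow_add _ _ ht0 ENNReal.ofReal_ne_top]; simp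
        _ < _ := ENNReal.mul_lt_mul (ENNReal.rpow_lt_rpow htf' h0) (ENNReal.rpow_lt_rpow htg' h1'))
  simp only [ENNReal.ofReal_toReal (fat _), ENNReal.ofReal_toReal (gat _),
    ENNReal.ofReal_toReal (hh1 _)] at key
  have key2 := (amgm h0 h1 _ _).trans (key.trans (lintegral_mono (fun x => min_le_left _ _)))
  simp only [div_eq_mul_inv] at key2
  rw [lintegral_mul_const _ hf, lintegral_mul_const _ hg, lintegral_mul_const _ hh,
    ← div_eq_mul_inv, ← div_eq_mul_inv, ← div_eq_mul_inv, ENNReal.div_rpow_of_nonneg _ _ h0.le,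
    ENNReal.div_rpow_of_nonneg _ _ h1'.le,
    ← ENNReal.mul_div_mul_comm (Or.inr (by simp [hb0, hbt])) (Or.inr (by simp [hb0, hbt])),
    ENNReal.div_le_iff hc0 hct, ENNReal.div_mul_cancel hc0 hct] at key2
  exact key2

theorem pl_gauss : PL (gaussianReal 0 1) := by
  intro l h0 h1 f g h hf hg hh f1 g1 hfg
  have h1' : 0 < 1 - l := sub_pos.2 h1
  have hm := measurable_gaussianPDF 0 1
  rw [gaussianReal_of_var_ne_zero _ one_ne_zero, lintegral_withDensity_eq_lintegral_mul _ hm hf,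
    lintegral_withDensity_eq_lintegral_mul _ hm hg, lintegral_withDensity_eq_lintegral_mul _ hm hh]
  have hp1 : ∀ x, gaussianPDF 0 1 x ≤ 1 := by
    intro x
    rw [gaussianPDF, gaussianPDFReal]
    apply ENNReal.ofReal_le_one.2
    apply mul_le_one₀
    · apply inv_le_one_of_one_le₀
      rw [Real.one_le_sqrt]
      have := Real.pi_gt_three
      norm_num; linarith
    · positivity
    · apply Real.exp_le_one_iff.2
      have : 0 ≤ (x - 0) ^ 2 / (2 * ((1 : ℝ≥0) : ℝ)) := by positivity
      rw [neg_div]; linarith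
  refine pl_volume l h0 h1 _ _ _ (hm.mul hf) (hm.mul hg) (hm.mul hh)
    (fun x => mul_le_one' (hp1 x) (f1 x)) (fun x => mul_le_one' (hp1 x) (g1 x)) ?_
  intro x y
  simp only [Pi.mul_apply]
  rw [ENNReal.mul_rpow_of_nonneg _ _ h0.le, ENNReal.mul_rpow_of_nonneg _ _ h1'.le,
    mul_mul_mul_comm]
  refine mul_le_mul' ?_ (hfg x y)
  simp only [gaussianPDF]
  rw [ENNReal.ofReal_rpow_of_pos (gaussianPDFReal_pos _ _ _ one_ne_zero),
    ENNReal.ofReal_rpow_of_pos (gaussianPDFReal_pos _ _ _ one_ne_zero),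
    ← ENNReal.ofReal_mul (by have := gaussianPDFReal_nonneg 0 1 x; positivity)]
  apply ENNReal.ofReal_le_ofReal
  simp only [gaussianPDFReal]
  rw [Real.mul_rpow (by positivity) (by positivity), Real.mul_rpow (by positivity) (by positivity),
    mul_mul_mul_comm, ← Real.rpow_add (by positivity), ← Real.exp_mul, ← Real.exp_mul,
    ← Real.exp_add]
  rw [add_sub_cancel, Real.rpow_one]
  apply mul_le_mul_of_nonneg_left _ (by positivity)
  apply Real.exp_le_exp.2
  simp only [smul_eq_mul, NNReal.coe_one, mul_one, sub_zero]
  nlinarith [mul_nonneg (mul_nonneg h0.le h1'.le) (sq_nonneg (x - y))]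

theorem PL.map {E F : Type*} [AddCommGroup E] [Module ℝ E] [MeasurableSpace E] [AddCommGroup F]
    [Module ℝ F] [MeasurableSpace F] {μ : Measure E} (h : PL μ) (L : E → F) (hL : Measurable L)
    (hlin : ∀ (s t : ℝ) x y, L (s • x + t • y) = s • L x + t • L y) : PL (μ.map L) := by
  intro l h0 h1 f g k hf hg hk f1 g1 hfg
  rw [lintegral_map hf hL, lintegral_map hg hL, lintegral_map hk hL]
  refine h l h0 h1 _ _ _ (hf.comp hL) (hg.comp hL) (hk.comp hL) (fun x => f1 _) (fun x => g1 _) ?_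
  intro x y
  simp only [hlin]
  exact hfg _ _

theorem PL.prod {E F : Type*} [AddCommGroup E] [Module ℝ E] [MeasurableSpace E] [AddCommGroup F]
    [Module ℝ F] [MeasurableSpace F] {μ : Measure E} {ν : Measure F} [SFinite μ]
    [IsProbabilityMeasure ν] (h : PL μ) (h' : PL ν) : PL (μ.prod ν) := by
  intro l h0 h1 f g k hf hg hk f1 g1 hfg
  rw [lintegral_prod _ hf.aemeasurable, lintegral_prod _ hg.aemeasurable,
    lintegral_prod _ hk.aemeasurable]
  have b1 : ∀ f : E × F → ℝ≥0∞, (∀ x, f x ≤ 1) → ∀ x, ∫⁻ y, f (x, y) ∂ν ≤ 1 := by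
    intro f f1 x
    calc ∫⁻ y, f (x, y) ∂ν ≤ ∫⁻ y, 1 ∂ν := lintegral_mono (fun y => f1 _)
      _ = 1 := by simp
  refine h l h0 h1 _ _ _ hf.lintegral_prod_right' hg.lintegral_prod_right' hk.lintegral_prod_right'
    (b1 f f1) (b1 g g1) ?_
  intro x x'
  refine h' l h0 h1 _ _ _ (hf.comp measurable_prodMk_left) (hg.comp measurable_prodMk_left)
    (hk.comp measurable_prodMk_left) (fun _ => f1 _) (fun _ => g1 _) ?_
  intro y y'
  exact hfg (x, y) (x', y')

theorem pl_pi_fin (n : ℕ) : PL (Measure.pi (fun _ : Fin n => gaussianReal 0 1)) := by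
  induction n with
  | zero =>
    intro l h0 h1 f g k hf hg hk f1 g1 hfg
    rw [Measure.pi_of_empty _ 0]
    rw [lintegral_dirac' _ hf, lintegral_dirac' _ hg, lintegral_dirac' _ hk]
    have := hfg 0 0
    simpa using this
  | succ n ih =>
    have h := (measurePreserving_piFinSuccAbove (fun _ : Fin (n+1) => gaussianReal 0 1) 0).symm
    rw [← h.map_eq]
    refine (pl_gauss.prod ih).map _ h.measurable ?_
    intro s t x y
    ext i
    refine Fin.cases ?_ (fun j => ?_) i <;> simp [MeasurableEquiv.piFinSuccAbove]

theorem pl_std (ι : Type*) [Fintype ι] : PL (stdGaussian (EuclideanSpace ℝ ι)) := by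
  rw [stdGaussian]
  refine (pl_pi_fin _).map _ (by fun_prop) ?_
  intro s t x y
  simp [Finset.smul_sum, add_smul, smul_smul, Finset.sum_add_distrib]

theorem pl_multi (ι : Type*) [Fintype ι] [DecidableEq ι] (S : Matrix ι ι ℝ) :
    PL (multivariateGaussian 0 S) := by
  rw [multivariateGaussian]
  refine (pl_std ι).map _ (by fun_prop) ?_
  intro s t x y
  simp


open MeasureTheory ProbabilityTheory Filter Set
open scoped ENNReal NNReal Topology

theorem anderson {E : Type*} [AddCommGroup E] [Module ℝ E] [MeasurableSpace E]
    [MeasurableAdd E] [MeasurableNeg E]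
    {μ : Measure E} (h : PL μ) (hs : μ.map (fun x => -x) = μ) {C : Set E} (hC : MeasurableSet C)
    (hconv : Convex ℝ C) (hsymm : ∀ x ∈ C, -x ∈ C) (x : E) {s : ℝ} (s0 : 0 ≤ s) (s1 : s < 1) :
    μ {y | x + y ∈ C} ≤ μ {y | s • x + y ∈ C} := by
  have m : ∀ x : E, MeasurableSet {y | x + y ∈ C} := fun x => measurable_const_add x hC
  set l : ℝ := (1 + s) / 2 with hl
  have h0 : 0 < l := by positivity
  have h1 : l < 1 := by rw [hl]; linarith
  have h1' : 0 < 1 - l := sub_pos.2 h1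
  have key := h l h0 h1 (indicator {y | x + y ∈ C} 1) (indicator {y | -x + y ∈ C} 1)
    (indicator {y | s • x + y ∈ C} 1) (measurable_const.indicator (m _))
    (measurable_const.indicator (m _)) (measurable_const.indicator (m _))
    (fun y => indicator_le_self' (by simp) y) (fun y => indicator_le_self' (by simp) y) (by
      intro y z
      by_cases hy : x + y ∈ C
      · by_cases hz : -x + z ∈ C
        · have : s • x + (l • y + (1 - l) • z) ∈ C := by
            have := hconv hy hz h0.le h1'.le (by ring)
            convert this using 1
            rw [hl]; module
          rw [indicator_of_mem (s := {y | s • x + y ∈ C}) this]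
          simp [indicator, hy, hz]
        · simp [indicator, hz, ENNReal.zero_rpow_of_pos h1']
      · simp [indicator, hy, ENNReal.zero_rpow_of_pos h0])
  rw [lintegral_indicator_one (m _), lintegral_indicator_one (m _), lintegral_indicator_one (m _)]
    at key
  have e : μ {y | -x + y ∈ C} = μ {y | x + y ∈ C} := by
    conv_lhs => rw [← hs, Measure.map_apply measurable_neg (m _)]
    congr 1
    ext y
    simp only [mem_preimage, mem_ofPred_eq]
    constructor
    · intro h; simpa [add_comm] using hsymm _ h
    · intro h; simpa [add_comm] using hsymm _ h
  rw [e] at key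
  refine le_trans (le_of_eq ?_) key
  rw [← ENNReal.rpow_add_of_nonneg _ _ h0.le h1'.le]; simp

structure CG {Ω : Type*} [MeasurableSpace Ω] (P : Measure Ω) {ι : Type*} [Fintype ι]
    (X : ι → Ω → ℝ) : Prop where
  meas : ∀ i, Measurable (X i)
  gauss : ∀ c : ι → ℝ, ∃ v : ℝ≥0, P.map (fun ω => ∑ i, c i * X i ω) = gaussianReal 0 v

section
variable {Ω : Type*} [MeasurableSpace Ω] {P : Measure Ω} {ι κ : Type*} [Fintype ι] [Fintype κ]
  {X : ι → Ω → ℝ}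

theorem CG.lin (h : CG P X) (A : κ → ι → ℝ) : CG P (fun k ω => ∑ i, A k i * X i ω) where
  meas k := by
    have := h.meas
    fun_prop
  gauss c := by
    obtain ⟨v, hv⟩ := h.gauss (fun i => ∑ k, c k * A k i)
    refine ⟨v, ?_⟩
    rw [← hv]
    congr 1
    ext ω
    simp_rw [Finset.mul_sum, Finset.sum_mul, mul_assoc]
    exact Finset.sum_comm

theorem CG.measurable_vec (h : CG P X) : Measurable (fun ω i => X i ω) := by
  have := h.meas
  fun_prop

theorem clm_pi_sum [DecidableEq ι] (L : StrongDual ℝ (ι → ℝ)) (x : ι → ℝ) :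
    L x = ∑ i, L (Pi.single i 1) * x i := by
  have := LinearMap.pi_apply_eq_sum_univ (L : (ι → ℝ) →ₗ[ℝ] ℝ) x
  simp only [ContinuousLinearMap.coe_coe, smul_eq_mul] at this
  rw [this]
  refine Finset.sum_congr rfl fun i _ => ?_
  rw [mul_comm]
  congr 2
  ext j
  simp [Pi.single_apply, eq_comm]

theorem CG.law (h : CG P X) : HasGaussianLaw (fun ω i => X i ω) P := by
  constructor
  have hm := h.measurable_vec
  refine @isGaussian_of_map_eq_gaussianReal (ι → ℝ) _ _ _ _ _ _ ?_
  intro L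
  classical
  obtain ⟨v, hv⟩ := h.gauss (fun i => L (Pi.single i 1))
  refine ⟨0, v, ?_⟩
  rw [← hv, Measure.map_map L.continuous.measurable hm]
  congr 1
  ext ω
  simp only [Function.comp]
  rw [clm_pi_sum]

theorem CG.single (h : CG P X) (i : ι) : ∃ v : ℝ≥0, P.map (X i) = gaussianReal 0 v := by
  classical
  obtain ⟨v, hv⟩ := h.gauss (Pi.single i 1)
  refine ⟨v, ?_⟩
  rw [← hv]
  congr 1
  ext ω
  simp [Pi.single_apply]

theorem memLp_of_map {Y : Ω → ℝ} (hY : Measurable Y) {v : ℝ≥0} (h : P.map Y = gaussianReal 0 v) :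
    MemLp Y 2 P := by
  have := memLp_id_gaussianReal' (μ := 0) (v := v) 2 (by simp)
  rw [← h, memLp_map_measure_iff (by fun_prop) hY.aemeasurable] at this
  exact this

theorem mean_of_map {Y : Ω → ℝ} (hY : Measurable Y) {v : ℝ≥0} (h : P.map Y = gaussianReal 0 v) :
    ∫ ω, Y ω ∂P = 0 := by
  have := integral_id_gaussianReal (μ := 0) (v := v)
  rw [← h, integral_map hY.aemeasurable (by fun_prop)] at this
  exact this

theorem var_of_map [IsProbabilityMeasure P] {Y : Ω → ℝ} (hY : Measurable Y) {v : ℝ≥0}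
    (h : P.map Y = gaussianReal 0 v) :
    ∫ ω, Y ω ^ 2 ∂P = v := by
  have := variance_id_gaussianReal (μ := 0) (v := v)
  rw [← h, variance_map (by fun_prop) hY.aemeasurable, Function.id_comp] at this
  rw [← this, variance_of_integral_eq_zero hY.aemeasurable (mean_of_map hY h)]

theorem CG.memLp (h : CG P X) (i : ι) : MemLp (X i) 2 P := by
  obtain ⟨v, hv⟩ := h.single i
  exact memLp_of_map (h.meas i) hv

theorem CG.mean (h : CG P X) (i : ι) : ∫ ω, X i ω ∂P = 0 := by
  obtain ⟨v, hv⟩ := h.single i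
  exact mean_of_map (h.meas i) hv

theorem CG.sq (h : CG P X) (c : ι → ℝ) : ∫ ω, (∑ i, c i * X i ω) ^ 2 ∂P
    = ∑ i, ∑ j, c i * c j * ∫ ω, X i ω * X j ω ∂P := by
  have e : ∀ ω, (∑ i, c i * X i ω) ^ 2 = ∑ i, ∑ j, c i * c j * (X i ω * X j ω) := by
    intro ω
    rw [pow_two, Finset.sum_mul_sum]
    refine Finset.sum_congr rfl fun i _ => Finset.sum_congr rfl fun j _ => by ring
  simp_rw [e]
  have hi : ∀ i j, Integrable (fun ω => c i * c j * (X i ω * X j ω)) P := fun i j =>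
    ((h.memLp i).integrable_mul (h.memLp j)).const_mul _
  rw [integral_finsetSum _ (fun i _ => integrable_finsetSum _ (fun j _ => hi i j))]
  refine Finset.sum_congr rfl fun i _ => ?_
  rw [integral_finsetSum _ (fun j _ => hi i j)]
  refine Finset.sum_congr rfl fun j _ => ?_
  rw [integral_const_mul]

theorem CG.map_comb [IsProbabilityMeasure P] (h : CG P X) (c : ι → ℝ) :
    P.map (fun ω => ∑ i, c i * X i ω)
      = gaussianReal 0 (∑ i, ∑ j, c i * c j * ∫ ω, X i ω * X j ω ∂P).toNNReal := by
  obtain ⟨v, hv⟩ := h.gauss c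
  have hm : Measurable (fun ω => ∑ i, c i * X i ω) := by
    have := h.meas
    fun_prop
  rw [← h.sq, var_of_map hm hv, hv]
  simp

theorem CG.map_eq [IsProbabilityMeasure P] {Ω' : Type*} [MeasurableSpace Ω'] {P' : Measure Ω'}
    [IsProbabilityMeasure P'] {X' : ι → Ω' → ℝ} (h : CG P X) (h' : CG P' X')
    (hc : ∀ i j, ∫ ω, X i ω * X j ω ∂P = ∫ ω, X' i ω * X' j ω ∂P') :
    P.map (fun ω i => X i ω) = P'.map (fun ω i => X' i ω) := by
  have := Measure.isProbabilityMeasure_map (μ := P) h.measurable_vec.aemeasurable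
  have := Measure.isProbabilityMeasure_map (μ := P') h'.measurable_vec.aemeasurable
  apply Measure.ext_of_charFunDual
  ext L
  classical
  rw [charFunDual_eq_charFun_map_one, charFunDual_eq_charFun_map_one]
  have e : ∀ x : ι → ℝ, L x = ∑ i, L (Pi.single i 1) * x i := clm_pi_sum L
  rw [Measure.map_map L.continuous.measurable h.measurable_vec,
    Measure.map_map L.continuous.measurable h'.measurable_vec]
  have e1 : (L ∘ fun ω i => X i ω) = fun ω => ∑ i, L (Pi.single i 1) * X i ω := funext fun ω => e _
  have e2 : (L ∘ fun ω i => X' i ω) = fun ω => ∑ i, L (Pi.single i 1) * X' i ω := funext fun ω => e _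
  rw [e1, e2]
  rw [h.map_comb, h'.map_comb]
  simp_rw [hc]

theorem multi_CG [DecidableEq ι] (S : Matrix ι ι ℝ) :
    CG (multivariateGaussian 0 S) (fun i (x : EuclideanSpace ℝ ι) => x i) where
  meas i := by fun_prop
  gauss c := by
    have hg : HasGaussianLaw (id : EuclideanSpace ℝ ι → _) (multivariateGaussian 0 S) :=
      IsGaussian.hasGaussianLaw_id
    set L : EuclideanSpace ℝ ι →L[ℝ] ℝ :=
      ∑ i, c i • (EuclideanSpace.proj i : EuclideanSpace ℝ ι →L[ℝ] ℝ) with hL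
    have := (hg.map L).map_eq_gaussianReal
    have e : (L ∘ id : EuclideanSpace ℝ ι → ℝ) = fun ω => ∑ i, c i * ω i := by
      ext ω
      simp [hL]
    have e2 : ∫ x, (L ∘ id : EuclideanSpace ℝ ι → ℝ) x ∂(multivariateGaussian 0 S) = 0 := by
      simp only [Function.comp_id]
      rw [ContinuousLinearMap.integral_comp_id_comm, integral_id_multivariateGaussian, map_zero]
      exact IsGaussian.integrable_id
    rw [e2, e] at this
    exact ⟨_, this⟩

theorem multi_cov [DecidableEq ι] {S : Matrix ι ι ℝ} (hS : S.PosSemidef) (i j : ι) :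
    ∫ x, x i * x j ∂(multivariateGaussian 0 S) = S i j := by
  rw [← covariance_eval_multivariateGaussian (μ := 0) hS i j,
    covariance_eq_sub ((multi_CG S).memLp i) ((multi_CG S).memLp j), (multi_CG S).mean i]
  simp

theorem CG.posSemidef (h : CG P X) : (Matrix.of fun i j => ∫ ω, X i ω * X j ω ∂P).PosSemidef := by
  apply Matrix.PosSemidef.of_dotProduct_mulVec_nonneg
  · unfold Matrix.IsHermitian
    ext i j
    rw [Matrix.conjTranspose_apply, Matrix.of_apply, Matrix.of_apply, star_trivial]
    exact integral_congr_ae (ae_of_all _ fun ω => mul_comm _ _)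
  · intro c
    have := h.sq c
    have h0 : 0 ≤ ∫ ω, (∑ i, c i * X i ω) ^ 2 ∂P := integral_nonneg fun ω => sq_nonneg _
    rw [this] at h0
    refine h0.trans_eq ?_
    simp only [dotProduct, Matrix.mulVec, Finset.mul_sum, Matrix.of_apply, star_trivial]
    refine Finset.sum_congr rfl fun i _ => Finset.sum_congr rfl fun j _ => by ring

theorem CG.pl [IsProbabilityMeasure P] (h : CG P X) : PL (P.map (fun ω i => X i ω)) := by
  classical
  rw [h.map_eq (multi_CG (Matrix.of fun i j => ∫ ω, X i ω * X j ω ∂P)) (by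
    intro i j
    rw [multi_cov h.posSemidef]; rfl)]
  apply (pl_multi ι _).map _ (by fun_prop)
  intro s t x y
  ext i
  simp

theorem CG.symm [IsProbabilityMeasure P] (h : CG P X) :
    (P.map (fun ω i => X i ω)).map (fun x => -x) = P.map (fun ω i => X i ω) := by
  rw [Measure.map_map measurable_neg h.measurable_vec]
  have h' : CG P (fun i ω => - X i ω) := by
    classical
    convert h.lin (fun k i => if k = i then -1 else 0) using 2
    simp
  rw [h.map_eq h' (by simp)]
  rfl

def box (b : ι → ℝ) : Set (ι → ℝ) := {x | ∀ i, |x i| ≤ b i}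

theorem box_meas (b : ι → ℝ) : MeasurableSet (box b) := by
  unfold box
  rw [ofPred_forall]
  apply MeasurableSet.iInter
  intro i
  exact measurableSet_le (by fun_prop) measurable_const

theorem box_convex (b : ι → ℝ) : Convex ℝ (box b) := by
  intro x hx y hy s t hs ht hst i
  have h1 := hx i
  have h2 := hy i
  rw [abs_le] at *
  simp only [Pi.add_apply, Pi.smul_apply, smul_eq_mul]
  constructor <;> nlinarith

theorem box_symm (b : ι → ℝ) : ∀ x ∈ box b, -x ∈ box b := by
  intro x hx i
  simpa using hx i

theorem CG.anderson [IsProbabilityMeasure P] (h : CG P X) (b : ι → ℝ) (x : ι → ℝ) {s : ℝ}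
    (s0 : 0 ≤ s) (s1 : s < 1) : P.map (fun ω i => X i ω) {y | x + y ∈ box b} ≤
      P.map (fun ω i => X i ω) {y | s • x + y ∈ box b} :=
  _root_.anderson h.pl h.symm (box_meas b) (box_convex b) (box_symm b) x s0 s1

theorem chebyshev_even {γ : Measure ℝ} [hγ : IsProbabilityMeasure γ] {φ : ℝ → ℝ≥0∞}
    (hφ : Measurable φ) {b : ℝ}
    (hmono : ∀ x y, |x| ≤ b → b < |y| → φ y ≤ φ x) :
    γ {y | |y| ≤ b} * ∫⁻ y, φ y ∂γ ≤ ∫⁻ y in {y | |y| ≤ b}, φ y ∂γ := by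
  set A := {y : ℝ | |y| ≤ b} with hA
  have mA : MeasurableSet A := measurableSet_le (by fun_prop) measurable_const
  by_cases hne : A.Nonempty
  swap
  · rw [Set.not_nonempty_iff_eq_empty] at hne
    simp [hne]
  set c := ⨅ x ∈ A, φ x with hc
  have h1 : γ A * c ≤ ∫⁻ y in A, φ y ∂γ := by
    rw [mul_comm, ← setLIntegral_const]
    exact setLIntegral_mono hφ (fun x hx => iInf₂_le x hx)
  have h2 : ∫⁻ y in Aᶜ, φ y ∂γ ≤ c * γ Aᶜ := by
    rw [← setLIntegral_const]
    refine setLIntegral_mono measurable_const (fun y hy => ?_)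
    refine le_iInf₂ fun x hx => hmono x y hx ?_
    simpa [hA] using hy
  rw [← lintegral_add_compl _ mA, mul_add]
  calc γ A * ∫⁻ y in A, φ y ∂γ + γ A * ∫⁻ y in Aᶜ, φ y ∂γ
      ≤ γ A * ∫⁻ y in A, φ y ∂γ + γ A * (c * γ Aᶜ) := by gcongr
    _ = γ A * ∫⁻ y in A, φ y ∂γ + γ Aᶜ * (γ A * c) := by ring
    _ ≤ γ A * ∫⁻ y in A, φ y ∂γ + γ Aᶜ * ∫⁻ y in A, φ y ∂γ := by gcongr
    _ = (γ A + γ Aᶜ) * ∫⁻ y in A, φ y ∂γ := by ring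
    _ = _ := by rw [measure_add_measure_compl mA]; simp

theorem CG.add [IsProbabilityMeasure P] {Ω' : Type*} [MeasurableSpace Ω'] {P' : Measure Ω'}
    [IsProbabilityMeasure P'] {Y : ι → Ω' → ℝ} (h : CG P X) (h' : CG P' Y) :
    CG (P.prod P') (fun i ω => X i ω.1 + Y i ω.2) where
  meas i := by
    have := h.meas i
    have := h'.meas i
    fun_prop
  gauss c := by
    obtain ⟨v, hv⟩ := h.gauss c
    obtain ⟨v', hv'⟩ := h'.gauss c
    refine ⟨v + v', ?_⟩
    have m : Measurable (fun ω => ∑ i, c i * X i ω) := by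
      have := h.meas
      fun_prop
    have m' : Measurable (fun ω => ∑ i, c i * Y i ω) := by
      have := h'.meas
      fun_prop
    have e := gaussianReal_conv_gaussianReal (m₁ := 0) (m₂ := 0) (v₁ := v) (v₂ := v')
    rw [add_zero] at e
    rw [← e, ← hv, ← hv', Measure.conv, Measure.map_prod_map _ _ m m',
      Measure.map_map (by fun_prop) (by fun_prop)]
    congr 1
    ext ω
    simp [mul_add, Finset.sum_add_distrib]

theorem CG.add_cov [IsProbabilityMeasure P] {Ω' : Type*} [MeasurableSpace Ω'] {P' : Measure Ω'}
    [IsProbabilityMeasure P'] {Y : ι → Ω' → ℝ} (h : CG P X) (h' : CG P' Y) (i j : ι) :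
    ∫ ω, (X i ω.1 + Y i ω.2) * (X j ω.1 + Y j ω.2) ∂(P.prod P')
      = ∫ ω, X i ω * X j ω ∂P + ∫ ω, Y i ω * Y j ω ∂P' := by
  have i1 : Integrable (fun ω : Ω × Ω' => X i ω.1 * X j ω.1) (P.prod P') :=
    ((h.memLp i).integrable_mul (h.memLp j)).comp_fst P'
  have i2 : Integrable (fun ω : Ω × Ω' => Y i ω.2 * Y j ω.2) (P.prod P') :=
    ((h'.memLp i).integrable_mul (h'.memLp j)).comp_snd P
  have i3 : ∀ i j, Integrable (fun ω : Ω × Ω' => X i ω.1 * Y j ω.2) (P.prod P') := fun i j =>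
    ((h.memLp i).integrable (by norm_num)).mul_prod ((h'.memLp j).integrable (by norm_num))
  have e : ∀ ω : Ω × Ω', (X i ω.1 + Y i ω.2) * (X j ω.1 + Y j ω.2)
    = (X i ω.1 * X j ω.1 + Y i ω.2 * Y j ω.2) + (X i ω.1 * Y j ω.2 + X j ω.1 * Y i ω.2) := by
    intro ω; ring
  simp_rw [e]
  have i4 : Integrable (fun ω : Ω × Ω' => X i ω.1 * X j ω.1 + Y i ω.2 * Y j ω.2) (P.prod P') :=
    i1.add i2
  have i5 : Integrable (fun ω : Ω × Ω' => X i ω.1 * Y j ω.2 + X j ω.1 * Y i ω.2) (P.prod P') :=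
    (i3 i j).add (i3 j i)
  rw [integral_add i4 i5, integral_add i1 i2,
    integral_add (i3 i j) (i3 j i), integral_prod_mul, integral_prod_mul, h.mean, h.mean]
  rw [integral_fun_fst (f := fun ω => X i ω * X j ω), integral_fun_snd (f := fun ω => Y i ω * Y j ω)]
  simp

theorem CG.box_eq (h : CG P X) (b : ι → ℝ) :
    P {ω | ∀ i, |X i ω| ≤ b i} = P.map (fun ω i => X i ω) (box b) := by
  rw [Measure.map_apply h.measurable_vec (box_meas b)]
  rfl

theorem CG.shift [IsProbabilityMeasure P] (h : CG P X) (b : ι → ℝ) (x : ι → ℝ) {s : ℝ}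
    (s0 : 0 ≤ s) (s1 : s < 1) : P {ω | ∀ i, |x i + X i ω| ≤ b i} ≤
      P {ω | ∀ i, |s * x i + X i ω| ≤ b i} := by
  have := h.anderson b x s0 s1
  have m : ∀ x : ι → ℝ, MeasurableSet {y | x + y ∈ box b} := fun x =>
    measurable_const_add x (box_meas b)
  rwa [Measure.map_apply h.measurable_vec (m x),
    Measure.map_apply h.measurable_vec (m (s • x))] at this

theorem CG.flip [IsProbabilityMeasure P] (h : CG P X) (b : ι → ℝ) (x : ι → ℝ) :
     P {ω | ∀ i, |- x i + X i ω| ≤ b i} = P {ω | ∀ i, |x i + X i ω| ≤ b i} := by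
  have h' : CG P (fun i ω => - X i ω) := by
    classical
    convert h.lin (fun k i => if k = i then -1 else 0) using 2
    simp
  have e := h.map_eq h' (by simp)
  have e1 := congrArg (fun μ => μ {y | x + y ∈ box b}) e
  have m : ∀ x : ι → ℝ, MeasurableSet {y | x + y ∈ box b} := fun x =>
    measurable_const_add x (box_meas b)
  rw [Measure.map_apply h.measurable_vec (m x),
    Measure.map_apply h'.measurable_vec (m x)] at e1
  refine Eq.trans ?_ e1.symm
  congr 1
  ext ω
  simp only [mem_ofPred_eq, mem_preimage, box, Pi.add_apply]
  refine forall_congr' fun i => ?_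
  rw [← abs_neg]; ring_nf

/-- the correlation bound used for the increments: `X = (first block) + independent`. -/
theorem CG.product_bound [IsProbabilityMeasure P] {Ω' : Type*} [MeasurableSpace Ω']
    {P' : Measure Ω'} [IsProbabilityMeasure P'] {X : ι ⊕ κ → Ω → ℝ} {Y : κ → Ω' → ℝ}
    (h : CG P X) (h' : CG P' Y) {S : Matrix (ι ⊕ κ) (ι ⊕ κ) ℝ} (hS : S.PosSemidef)
    (h1 : ∀ i a, ∫ ω, X (.inl i) ω * X a ω ∂P = S (.inl i) a)
    (h2 : ∀ i j, ∫ ω, X (.inr i) ω * X (.inr j) ω ∂P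
      = S (.inr i) (.inr j) + ∫ ω, Y i ω * Y j ω ∂P') (b : ι ⊕ κ → ℝ) :
    P {ω | ∀ a, |X a ω| ≤ b a} ≤
      P {ω | ∀ i, |X (.inl i) ω| ≤ b (.inl i)} * P' {ω | ∀ j, |Y j ω| ≤ b (.inr j)} := by
  classical
  set Q := multivariateGaussian (0 : EuclideanSpace ℝ (ι ⊕ κ)) S with hQ
  have hx := multi_CG S
  have hy : CG P' (Sum.elim (fun (_ : ι) _ => (0:ℝ)) Y) := by
    convert h'.lin (Sum.elim (fun (_ : ι) _ => (0:ℝ)) (fun k i => if k = i then 1 else 0)) using 2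
      with a
    cases a <;> simp
  have hz := hx.add hy
  have cov : ∀ a a', ∫ ω, X a ω * X a' ω ∂P = S a a' + ∫ ω, (Sum.elim (fun (_ : ι) _ => (0:ℝ)) Y) a ω
     * (Sum.elim (fun (_ : ι) _ => (0:ℝ)) Y) a' ω ∂P' := by
    intro a a'
    rcases a with i | j
    · simp [h1]
    · rcases a' with i' | j'
      · have := hS.1.apply (.inr j) (.inl i')
        rw [star_trivial] at this
        rw [← this, ← h1]
        simp [mul_comm]
      · simp [h2]
  have e := h.map_eq hz (by
    intro a a'
    rw [hx.add_cov hy, multi_cov hS, cov])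
  have el : P {ω | ∀ i, |X (.inl i) ω| ≤ b (.inl i)} = Q {x | ∀ i, |x (.inl i)| ≤ b (.inl i)} := by
    have := congrArg (fun μ => μ {x | ∀ i, |x (.inl i)| ≤ b (.inl i)}) e
    have m : MeasurableSet {x : ι ⊕ κ → ℝ | ∀ i, |x (.inl i)| ≤ b (.inl i)} := by
      rw [ofPred_forall]
      exact MeasurableSet.iInter fun i => measurableSet_le (by fun_prop) measurable_const
    rw [Measure.map_apply h.measurable_vec m, Measure.map_apply hz.measurable_vec m] at this
    refine this.trans ?_
    have e3 : ((fun (ω : EuclideanSpace ℝ (ι ⊕ κ) × Ω') i => ω.1 i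
      + (Sum.elim (fun (_ : ι) _ => (0:ℝ)) Y) i ω.2) ⁻¹'
      {x | ∀ (i : ι), |x (Sum.inl i)| ≤ b (Sum.inl i)})
      = {x | ∀ i, |x (.inl i)| ≤ b (.inl i)} ×ˢ univ := by
      ext ω
      simp
    rw [e3, Measure.prod_prod]
    simp [hQ]
  rw [h.box_eq, e, ← hz.box_eq, el]
  have mz : MeasurableSet {ω : EuclideanSpace ℝ (ι ⊕ κ) × Ω' | ∀ i, |ω.1 i
      + (Sum.elim (fun (_ : ι) _ => (0:ℝ)) Y) i ω.2| ≤ b i} := hz.measurable_vec (box_meas b)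
  rw [Measure.prod_apply mz]
  have mq : MeasurableSet {x : EuclideanSpace ℝ (ι ⊕ κ) | ∀ i, |x (.inl i)| ≤ b (.inl i)} := by
      rw [ofPred_forall]
      exact MeasurableSet.iInter fun i => measurableSet_le (by fun_prop) measurable_const
  rw [mul_comm, ← lintegral_indicator_const mq]
  refine lintegral_mono fun x => ?_
  by_cases hxq : x ∈ {x : EuclideanSpace ℝ (ι ⊕ κ) | ∀ i, |x (.inl i)| ≤ b (.inl i)}
  · rw [indicator_of_mem hxq]
    have := h'.shift (fun j => b (.inr j)) (fun j => x (.inr j)) (s := 0) le_rfl one_pos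
    simp only [zero_mul, zero_add] at this
    refine le_trans (measure_mono ?_) this
    intro ω hω j
    simpa using hω (.inr j)
  · rw [indicator_of_notMem hxq]
    refine le_of_eq (measure_mono_null ?_ measure_empty)
    intro ω hω
    exact hxq fun i => by simpa using hω (.inl i)

theorem CG.sidak_step [IsProbabilityMeasure P] {X : Option ι → Ω → ℝ} (h : CG P X)
    (b : Option ι → ℝ) :
    P {ω | |X none ω| ≤ b none} * P {ω | ∀ i, |X (some i) ω| ≤ b (some i)}
      ≤ P {ω | ∀ i, |X i ω| ≤ b i} := by
  classical
  set v := ∫ ω, X none ω * X none ω ∂P with hv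
  set a : ι → ℝ := fun i => (∫ ω, X (some i) ω * X none ω ∂P) / v with ha
  have hav : ∀ i, a i * v = ∫ ω, X (some i) ω * X none ω ∂P := by
    intro i
    by_cases h0 : v = 0
    · have h1 : ∫ ω, X none ω * X none ω ∂P = 0 := h0
      rw [integral_eq_zero_iff_of_nonneg (fun ω => mul_self_nonneg _)
        ((h.memLp none).integrable_mul (h.memLp none))] at h1
      rw [h0, mul_zero, eq_comm]
      refine integral_eq_zero_of_ae ?_
      filter_upwards [h1] with ω hω
      have : X none ω = 0 := mul_self_eq_zero.1 hω
      simp [this]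
    · simp only [ha]; field_simp
  -- the two independent parts
  set U : Option ι → Ω → ℝ := fun o ω => o.elim 1 a * X none ω with hU
  set W : Option ι → Ω → ℝ := fun o ω => X o ω - U o ω with hW
  have cU : CG P U := by
    convert h.lin (fun (o : Option ι) (k : Option ι) => if k = none then o.elim 1 a else 0) using 2
    simp [hU]
  have cW : CG P W := by
    convert h.lin (fun (o : Option ι) (k : Option ι) => (if k = o then 1 else 0) - if k = none then o.elim 1 a else 0) using 2
      with o
    ext ω
    simp only [sub_mul, Finset.sum_sub_distrib]
    simp [hU, hW]
  have hz := cU.add cW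
  have m2 : ∀ o k, Integrable (fun ω => X o ω * X k ω) P := fun o k =>
    (h.memLp o).integrable_mul (h.memLp k)
  have hXn : ∀ o : Option ι, ∫ ω, X o ω * X none ω ∂P = o.elim 1 a * v := by
    intro o
    cases o with
    | none => simp [hv]
    | some i => simp [hav]
  have e := h.map_eq hz (by
    intro o k
    rw [cU.add_cov cW]
    have e1 : ∀ ω, W o ω * W k ω = X o ω * X k ω - k.elim 1 a * (X o ω * X none ω)
      - o.elim 1 a * (X k ω * X none ω) + o.elim 1 a * k.elim 1 a * (X none ω * X none ω) := by
      intro ω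
      simp only [hW, hU]; ring
    have e2 : ∀ ω, U o ω * U k ω = o.elim 1 a * k.elim 1 a * (X none ω * X none ω) := by
      intro ω
      simp only [hU]; ring
    simp_rw [e1, e2]
    rw [integral_add (by fun_prop) (by fun_prop), integral_sub (by fun_prop) (by fun_prop),
      integral_sub (by fun_prop) (by fun_prop)]
    simp only [integral_const_mul]
    rw [hXn o, hXn k, ← hv]
    ring)
  have cW' : CG P (fun i => W (some i)) := by
    convert cW.lin (fun (i : ι) (k : Option ι) => if k = some i then 1 else 0) using 2
    simp
  set φ : ℝ → ℝ≥0∞ := fun y => P {ω | ∀ i, |y * a i + W (some i) ω| ≤ b (some i)} with hφ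
  have mφ' : MeasurableSet {p : ℝ × Ω | ∀ i, |p.1 * a i + W (some i) p.2| ≤ b (some i)} := by
    rw [ofPred_forall]
    refine MeasurableSet.iInter fun i => measurableSet_le ?_ measurable_const
    have := cW'.meas i
    fun_prop
  have mφ : Measurable φ := measurable_measure_prodMk_left mφ'
  have hmono : ∀ x y, |x| ≤ b none → b none < |y| → φ y ≤ φ x := by
    intro x y hx hy
    have hxy : |x| < |y| := lt_of_le_of_lt hx hy
    have hev : ∀ y, φ |y| = φ y := by
      intro y
      rcases abs_choice y with hy | hy
      · rw [hy]
      · rw [hy]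
        have := cW'.flip (fun i => b (some i)) (fun i => y * a i)
        simp only [hφ, neg_mul]
        exact this
    rw [← hev x, ← hev y]
    have hy0 : 0 < |y| := lt_of_le_of_lt (abs_nonneg x) hxy
    have := cW'.shift (fun i => b (some i)) (fun i => |y| * a i) (s := |x| / |y|)
      (by positivity) ((div_lt_one hy0).2 hxy)
    simp only [hφ]
    convert this using 6
    field_simp
  have key := chebyshev_even (γ := P.map (X none)) (hγ := Measure.isProbabilityMeasure_map (h.meas none).aemeasurable) mφ hmono
  have mA : MeasurableSet {y : ℝ | |y| ≤ b none} := measurableSet_le (by fun_prop) measurable_const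
  rw [Measure.map_apply (h.meas none) mA, lintegral_map mφ (h.meas none),
    ← lintegral_indicator mA, lintegral_map (mφ.indicator mA) (h.meas none)] at key
  have R1 : P {ω | ∀ i, |X i ω| ≤ b i} = ∫⁻ ω, indicator {y : ℝ | |y| ≤ b none} φ (X none ω) ∂P := by
    have mz : MeasurableSet {ω : Ω × Ω | ∀ i, |U i ω.1 + W i ω.2| ≤ b i} :=
      hz.measurable_vec (box_meas b)
    rw [h.box_eq, e, ← hz.box_eq, Measure.prod_apply mz]
    refine lintegral_congr fun ω => ?_
    by_cases hω : X none ω ∈ {y : ℝ | |y| ≤ b none}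
    · rw [indicator_of_mem hω]
      simp only [hφ]
      congr 1
      ext ω'
      have : |X none ω| ≤ b none := hω
      simp [Option.forall, hU, hW, mul_comm, this]
    · rw [indicator_of_notMem hω]
      refine measure_mono_null ?_ measure_empty
      intro ω' hω'
      exact hω (by simpa [hU, hW] using hω' none)
  have R2 : P {ω | ∀ i, |X (some i) ω| ≤ b (some i)} = ∫⁻ ω, φ (X none ω) ∂P := by
    have m : MeasurableSet {x : Option ι → ℝ | ∀ i, |x (some i)| ≤ b (some i)} := by
      rw [ofPred_forall]
      exact MeasurableSet.iInter fun i => measurableSet_le (by fun_prop) measurable_const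
    have := congrArg (fun μ => μ {x | ∀ i, |x (some i)| ≤ b (some i)}) e
    rw [Measure.map_apply h.measurable_vec m, Measure.map_apply hz.measurable_vec m] at this
    refine this.trans ?_
    rw [Measure.prod_apply (hz.measurable_vec m)]
    refine lintegral_congr fun ω => ?_
    simp only [hφ]
    congr 1
    ext ω'
    simp [hU, mul_comm]
  rw [R1, R2]
  exact key

theorem CG.sidak [IsProbabilityMeasure P] : ∀ (n : ℕ) {X : Fin n → Ω → ℝ} (_ : CG P X)
    (b : Fin n → ℝ), ∏ i, P {ω | |X i ω| ≤ b i} ≤ P {ω | ∀ i, |X i ω| ≤ b i} := by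
  intro n
  induction n with
  | zero => intro X h b; simp
  | succ n ih =>
    intro X h b
    have h' : CG P (fun o : Option (Fin n) => X (o.elim 0 Fin.succ)) := by
      classical
      convert h.lin (fun (o : Option (Fin n)) (k : Fin (n+1)) => if k = o.elim 0 Fin.succ then 1 else 0) using 2
      simp
    have h'' : CG P (fun i : Fin n => X i.succ) := by
      classical
      convert h.lin (fun (o : Fin n) (k : Fin (n+1)) => if k = o.succ then 1 else 0) using 2
      simp
    have := h'.sidak_step (fun o => b (o.elim 0 Fin.succ))
    rw [Fin.prod_univ_succ]
    refine le_trans (mul_le_mul_right (ih h'' (fun i => b i.succ)) _) (le_trans this ?_)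
    refine measure_mono fun ω hω => ?_
    intro i
    refine Fin.cases ?_ (fun i => ?_) i
    · exact hω none
    · exact hω (some i)

end

open MeasureTheory ProbabilityTheory Filter Set
open scoped ENNReal NNReal Topology

section
variable {Ω : Type*} [MeasurableSpace Ω] {P : Measure Ω} {H : ℝ} {R : ℝ → Ω → ℝ}

theorem IsGaussianRL.cg (hR : IsGaussianRL P R H) {ι : Type*} [Fintype ι] (t : ι → ℝ)
    (ht : ∀ i, 0 ≤ t i) : CG P (fun i => R (t i)) where
  meas i := hR.meas _
  gauss c := by
    let e := Fintype.equivFin ι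
    obtain ⟨v, hv⟩ := hR.gaussian _ (fun i => t (e.symm i)) (fun i => c (e.symm i)) (fun i => ht _)
    refine ⟨v, ?_⟩
    rw [← hv]
    congr 1
    ext ω
    exact (Equiv.sum_comp e.symm (fun i => c i * R (t i) ω)).symm

/-- the kernel of the Riemann-Liouville process -/
noncomputable def RLK (H t u : ℝ) : ℝ := if u ≤ t then (t - u) ^ (H - 1/2) else 0

theorem RLK_meas (H t : ℝ) : Measurable (RLK H t) := by
  unfold RLK
  refine Measurable.ite measurableSet_Iic ?_ measurable_const
  fun_prop

theorem RLK_memLp (hH : 0 < H) {t : ℝ} (ht : 0 ≤ t) (T : ℝ) :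
    MemLp (RLK H t) 2 (volume.restrict (Ioc 0 T)) := by
  rw [memLp_two_iff_integrable_sq (RLK_meas H t).aestronglyMeasurable]
  have h1 : IntervalIntegrable (fun u => (t - u) ^ (2 * H - 1)) volume 0 t := by
    have := (intervalIntegral.intervalIntegrable_rpow' (a := 0) (b := t) (r := 2 * H - 1) (by linarith)).comp_sub_left t
    simpa using this.symm
  rw [intervalIntegrable_iff_integrableOn_Ioc_of_le ht] at h1
  have h2 : IntegrableOn (indicator (Ioc 0 t) (fun u => (t - u) ^ (2 * H - 1))) (Ioc 0 T) :=
    ((integrable_indicator_iff measurableSet_Ioc).2 h1).integrableOn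
  refine h2.congr_fun ?_ measurableSet_Ioc
  intro u hu
  by_cases hut : u ≤ t
  · simp only [RLK, hut, if_true]
    rw [indicator_of_mem (show u ∈ Ioc 0 t from ⟨hu.1, hut⟩), ← Real.rpow_natCast, ← Real.rpow_mul (by linarith)]
    congr 1
    push_cast; ring
  · simp only [RLK, hut, if_false]
    rw [indicator_of_notMem (fun h => hut h.2)]
    simp

theorem RLK_int (hH : 0 < H) {s t : ℝ} (hs : 0 ≤ s) (ht : 0 ≤ t) (T : ℝ) :
    IntegrableOn (fun u => RLK H s u * RLK H t u) (Ioc 0 T) :=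
  (RLK_memLp hH hs T).integrable_mul (RLK_memLp hH ht T)

theorem RLK_mul (s t u : ℝ) : RLK H s u * RLK H t u =
    indicator (Iic (min s t)) (fun u => (t - u) ^ (H - 1/2) * (s - u) ^ (H - 1/2)) u := by
  by_cases h1 : u ≤ s <;> by_cases h2 : u ≤ t <;> simp [RLK, indicator, h1, h2, mul_comm]

theorem IsGaussianRL.covK (hR : IsGaussianRL P R H) {s t T : ℝ} (hs : 0 ≤ s) (ht : 0 ≤ t)
    (hT : min s t ≤ T) :
    ∫ ω, R s ω * R t ω ∂P = ∫ u in Ioc 0 T, RLK H s u * RLK H t u := by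
  rw [hR.cov s t hs ht]
  simp_rw [RLK_mul]
  rw [setIntegral_indicator measurableSet_Iic]
  congr 2
  ext u
  simp only [mem_Ioc, mem_inter_iff, mem_Iic]
  constructor
  · rintro ⟨h1, h2⟩
    exact ⟨⟨h1, h2.trans hT⟩, h2⟩
  · rintro ⟨⟨h1, h2⟩, h3⟩
    exact ⟨h1, h3⟩

theorem RLK_gram (hH : 0 < H) {ι : Type*} [Fintype ι] (t : ι → ℝ)
    (ht : ∀ i, 0 ≤ t i) (T : ℝ) (c : ι → ℝ) :
    ∑ i, ∑ j, c i * c j * ∫ u in Ioc 0 T, RLK H (t i) u * RLK H (t j) u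
      = ∫ u in Ioc 0 T, (∑ i, c i * RLK H (t i) u) ^ 2 := by
  have e : ∀ u, (∑ i, c i * RLK H (t i) u) ^ 2
      = ∑ i, ∑ j, c i * c j * (RLK H (t i) u * RLK H (t j) u) := by
    intro ω
    rw [pow_two, Finset.sum_mul_sum]
    refine Finset.sum_congr rfl fun i _ => Finset.sum_congr rfl fun j _ => by ring
  simp_rw [e]
  have hi : ∀ i j, IntegrableOn (fun u => c i * c j * (RLK H (t i) u * RLK H (t j) u)) (Ioc 0 T) :=
    fun i j => (RLK_int hH (ht i) (ht j) T).const_mul _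
  rw [integral_finsetSum _ (fun i _ => integrable_finsetSum _ (fun j _ => hi i j))]
  refine Finset.sum_congr rfl fun i _ => ?_
  rw [integral_finsetSum _ (fun j _ => hi i j)]
  refine Finset.sum_congr rfl fun j _ => ?_
  rw [integral_const_mul]

theorem IsGaussianRL.var (hR : IsGaussianRL P R H) (hH : 0 < H) {ι : Type*} [Fintype ι] (t : ι → ℝ)
    {T : ℝ} (ht : ∀ i, 0 ≤ t i) (hT : ∀ i, t i ≤ T) (c : ι → ℝ) :
    ∫ ω, (∑ i, c i * R (t i) ω) ^ 2 ∂P = ∫ u in Ioc 0 T, (∑ i, c i * RLK H (t i) u) ^ 2 := by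
  rw [(hR.cg t ht).sq, ← RLK_gram hH t ht]
  refine Finset.sum_congr rfl fun i _ => Finset.sum_congr rfl fun j _ => ?_
  rw [hR.covK (ht i) (ht j) ((min_le_left _ _).trans (hT i))]

theorem IsGaussianRL.cov_scale (hR : IsGaussianRL P R H) {s t c : ℝ} (hs : 0 ≤ s)
    (ht : 0 ≤ t) (hc : 0 < c) :
    ∫ ω, R (c * s) ω * R (c * t) ω ∂P = c ^ H * c ^ H * ∫ ω, R s ω * R t ω ∂P := by
  rw [hR.cov _ _ (by positivity) (by positivity), hR.cov _ _ hs ht,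
    ← mul_min_of_nonneg _ _ hc.le]
  have hm : 0 ≤ min s t := le_min hs ht
  rw [← intervalIntegral.integral_of_le hm, ← intervalIntegral.integral_of_le (by positivity)]
  have := intervalIntegral.mul_integral_comp_mul_left (a := 0) (b := min s t)
    (f := fun u => (c * t - u) ^ (H - 1/2) * (c * s - u) ^ (H - 1/2)) c
  rw [mul_zero] at this
  rw [← this, ← intervalIntegral.integral_const_mul, ← intervalIntegral.integral_const_mul]
  refine intervalIntegral.integral_congr fun u hu => ?_
  rw [uIcc_of_le hm] at hu
  have h1 : 0 ≤ t - u := by linarith [hu.2.trans (min_le_right s t)]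
  have h2 : 0 ≤ s - u := by linarith [hu.2.trans (min_le_left s t)]
  rw [← mul_sub, ← mul_sub, Real.mul_rpow hc.le h1, Real.mul_rpow hc.le h2]
  have : c * (c ^ (H - 1/2) * c ^ (H - 1/2)) = c ^ H * c ^ H := by
    conv_lhs => rw [← Real.rpow_one c]
    rw [← Real.rpow_mul hc.le, ← Real.rpow_add hc, ← Real.rpow_add hc, ← Real.rpow_add hc]
    congr 1; ring
  linear_combination ((t - u) ^ (H - 1 / 2) * (s - u) ^ (H - 1 / 2)) * this

theorem IsGaussianRL.cov_shift (hR : IsGaussianRL P R H) (hH : 0 < H) {s t τ : ℝ} (hs : 0 ≤ s)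
    (ht : 0 ≤ t) (hτ : 0 ≤ τ) :
    ∫ ω, R (τ + s) ω * R (τ + t) ω ∂P = (∫ u in Ioc 0 τ, RLK H (τ + s) u * RLK H (τ + t) u)
      + ∫ ω, R s ω * R t ω ∂P := by
  have hm : 0 ≤ min s t := le_min hs ht
  have hi := RLK_int hH (s := τ + s) (t := τ + t) (by positivity) (by positivity)
  rw [hR.covK (T := τ + min s t) (by positivity) (by positivity) (min_add_add_left τ s t).le,
    hR.covK hs ht le_rfl]
  rw [← intervalIntegral.integral_of_le hm, ← intervalIntegral.integral_of_le hτ,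
    ← intervalIntegral.integral_of_le (by positivity)]
  have i1 : IntervalIntegrable (fun u => RLK H (τ + s) u * RLK H (τ + t) u) volume 0 τ := by
    rw [intervalIntegrable_iff_integrableOn_Ioc_of_le hτ]; exact hi _
  have i2 : IntervalIntegrable (fun u => RLK H (τ + s) u * RLK H (τ + t) u) volume τ (τ + min s t) := by
    rw [intervalIntegrable_iff_integrableOn_Ioc_of_le (by linarith)]
    exact (hi (τ + min s t)).mono_set (Ioc_subset_Ioc_left hτ)
  rw [← intervalIntegral.integral_add_adjacent_intervals i1 i2]
  congr 1
  have := intervalIntegral.integral_comp_add_left (a := 0) (b := min s t)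
    (fun u => RLK H (τ + s) u * RLK H (τ + t) u) τ
  rw [add_zero] at this
  rw [← this]
  refine intervalIntegral.integral_congr fun u _ => ?_
  simp [RLK]

theorem IsGaussianRL.prod_le [IsProbabilityMeasure P] (hR : IsGaussianRL P R H) (hH : 0 < H)
    {ι κ : Type*} [Fintype ι] [Fintype κ] {s : ι → ℝ} {t : κ → ℝ} {τ : ℝ}
    (hs : ∀ i, 0 ≤ s i) (hs' : ∀ i, s i ≤ τ) (ht : ∀ i, 0 ≤ t i) (hτ : 0 ≤ τ) (ε : ℝ) :
    P {ω | (∀ i, |R (s i) ω| ≤ ε) ∧ ∀ j, |R (τ + t j) ω| ≤ ε} ≤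
      P {ω | ∀ i, |R (s i) ω| ≤ ε} * P {ω | ∀ j, |R (t j) ω| ≤ ε} := by
  set w : ι ⊕ κ → ℝ := Sum.elim s (fun j => τ + t j) with hw
  have hw0 : ∀ a, 0 ≤ w a := by
    rintro (i | j)
    · exact hs i
    · have := ht j; simp only [hw, Sum.elim_inr]; positivity
  have := (hR.cg w hw0).product_bound (hR.cg t ht) (b := fun _ => ε)
    (S := Matrix.of fun a b => ∫ u in Ioc 0 τ, RLK H (w a) u * RLK H (w b) u) (by
      apply Matrix.PosSemidef.of_dotProduct_mulVec_nonneg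
      · unfold Matrix.IsHermitian
        ext i j
        rw [Matrix.conjTranspose_apply, Matrix.of_apply, Matrix.of_apply, star_trivial]
        exact integral_congr_ae (ae_of_all _ fun ω => mul_comm _ _)
      · intro c
        have h0 : 0 ≤ ∫ u in Ioc 0 τ, (∑ i, c i * RLK H (w i) u) ^ 2 :=
          integral_nonneg fun ω => sq_nonneg _
        rw [← RLK_gram hH w hw0] at h0
        refine h0.trans_eq ?_
        simp only [dotProduct, Matrix.mulVec, Finset.mul_sum, Matrix.of_apply, star_trivial]
        refine Finset.sum_congr rfl fun i _ => Finset.sum_congr rfl fun j _ => by ring)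
    (by
      intro i a
      rw [hR.covK (hw0 _) (hw0 _) ((min_le_left _ _).trans (hs' i))]
      rfl)
    (by
      intro i j
      exact hR.cov_shift hH (ht i) (ht j) hτ)
  simpa [Sum.forall, hw] using this

theorem IsGaussianRL.scale [IsProbabilityMeasure P] (hR : IsGaussianRL P R H)
    {ι : Type*} [Fintype ι] {t : ι → ℝ} {c : ℝ} (ht : ∀ i, 0 ≤ t i) (hc : 0 < c) (ε : ℝ) :
    P {ω | ∀ i, |R (c * t i) ω| ≤ ε} = P {ω | ∀ i, |R (t i) ω| ≤ ε * c ^ (-H)} := by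
  have h1 := hR.cg (fun i => c * t i) (fun i => mul_nonneg hc.le (ht i))
  have h2 : CG P (fun i ω => c ^ H * R (t i) ω) := by
    classical
    convert (hR.cg t ht).lin (fun i j => if j = i then c ^ H else 0) using 2
    simp
  have e := h1.map_eq h2 (by
    intro i j
    rw [hR.cov_scale (ht i) (ht j) hc, ← integral_const_mul]
    congr 1
    ext ω
    ring)
  rw [h1.box_eq, e, ← h2.box_eq]
  congr 1
  ext ω
  simp only [mem_ofPred_eq]
  refine forall_congr' fun i => ?_
  have : 0 < c ^ H := by positivity
  rw [abs_mul, abs_of_pos this, Real.rpow_neg hc.le, ← div_eq_mul_inv, le_div_iff₀ this, mul_comm]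

/-- the small ball probability -/
noncomputable def smallBall (P : Measure Ω) (R : ℝ → Ω → ℝ) (ε : ℝ) : ℝ≥0∞ :=
  P {ω | ∀ t ∈ Icc (0:ℝ) 1, |R t ω| ≤ ε}

theorem smallBall_tendsto [IsProbabilityMeasure P] (hm : ∀ t, Measurable (R t))
    (hcont : ∀ ω, ContinuousOn (fun t => R t ω) (Icc 0 1)) {d : ℕ → ℝ}
    (hd : ∀ n, d n ∈ Icc (0:ℝ) 1) (hd' : Icc (0:ℝ) 1 ⊆ closure (range d)) (ε : ℝ) :
    Tendsto (fun n : ℕ => P {ω | ∀ i : Fin n, |R (d i) ω| ≤ ε}) atTop (𝓝 (smallBall P R ε)) := by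
  have e : {ω | ∀ t ∈ Icc (0:ℝ) 1, |R t ω| ≤ ε} = ⋂ n : ℕ, {ω | ∀ i : Fin n, |R (d i) ω| ≤ ε} := by
    ext ω
    simp only [mem_ofPred_eq, mem_iInter]
    constructor
    · intro h n i
      exact h _ (hd _)
    · intro h t ht
      have h' : ∀ n, |R (d n) ω| ≤ ε := fun n => h (n+1) ⟨n, Nat.lt_succ_self n⟩
      have h1 := (hcont ω t ht).abs
      have h2 : t ∈ closure (range d) := hd' ht
      have h3 : ContinuousWithinAt (fun t => |R t ω|) (range d) t :=
        h1.mono (range_subset_iff.2 hd)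
      have h4 := h3.mem_closure_image h2
      have h5 : closure ((fun t => |R t ω|) '' range d) ⊆ Iic ε :=
        closure_minimal (by rintro _ ⟨_, ⟨n, rfl⟩, rfl⟩; exact h' n) isClosed_Iic
      exact h5 h4
  rw [smallBall, e]
  refine tendsto_measure_iInter_atTop (fun n => ?_) ?_ ⟨0, measure_ne_top _ _⟩
  · apply MeasurableSet.nullMeasurableSet
    rw [ofPred_forall]
    exact MeasurableSet.iInter fun i => measurableSet_le (hm _).abs measurable_const
  · intro m n hmn ω hω i
    exact hω (Fin.castLE hmn i)

theorem exists_denseSeq : ∃ d : ℕ → ℝ, (∀ n, d n ∈ Icc (0:ℝ) 1) ∧ Icc (0:ℝ) 1 ⊆ closure (range d) := by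
  refine ⟨fun n => TopologicalSpace.denseSeq (Icc (0:ℝ) 1) n, fun n => Subtype.coe_prop _, ?_⟩
  intro t ht
  have := TopologicalSpace.denseRange_denseSeq (Icc (0:ℝ) 1) ⟨t, ht⟩
  have h2 := (continuous_subtype_val (p := fun t => t ∈ Icc (0:ℝ) 1)).continuousWithinAt.mem_closure_image (s := range (TopologicalSpace.denseSeq (Icc (0:ℝ) 1))) this
  rw [← range_comp] at h2
  exact h2

theorem IsGaussianRL.submul [IsProbabilityMeasure P] (hR : IsGaussianRL P R H) (hH : 0 < H)
    (hcont : ∀ ω, ContinuousOn (fun t => R t ω) (Icc 0 1)) {τ : ℝ} (h0 : 0 < τ) (h1 : τ < 1)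
    (ε : ℝ) : smallBall P R ε ≤ smallBall P R (ε * τ ^ (-H)) * smallBall P R (ε * (1 - τ) ^ (-H)) := by
  obtain ⟨d, hd, hd'⟩ := exists_denseSeq
  have h1' : 0 < 1 - τ := sub_pos.2 h1
  have T1 := smallBall_tendsto (P := P) hR.meas hcont hd hd' (ε * τ ^ (-H))
  have T2 := smallBall_tendsto (P := P) hR.meas hcont hd hd' (ε * (1 - τ) ^ (-H))
  have T3 := ENNReal.Tendsto.mul T1 (Or.inr (measure_ne_top _ _)) T2 (Or.inr (measure_ne_top _ _))
  refine ge_of_tendsto' T3 fun n => ?_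
  rw [← hR.scale (fun i : Fin n => (hd i).1) h0, ← hR.scale (fun i : Fin n => (hd i).1) h1']
  refine le_trans (measure_mono ?_) (hR.prod_le hH (τ := τ) (fun i : Fin n => mul_nonneg h0.le (hd i).1)
    (fun i : Fin n => mul_le_of_le_one_right h0.le (hd i).2) (fun i : Fin n => mul_nonneg h1'.le (hd i).1) h0.le ε)
  intro ω hω
  refine ⟨fun i => hω _ ⟨mul_nonneg h0.le (hd i).1, ?_⟩, fun i => hω _ ⟨?_, ?_⟩⟩
  · nlinarith [(hd i).1, (hd i).2]
  · nlinarith [(hd i).1, (hd i).2]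
  · nlinarith [(hd i).1, (hd i).2]

end

open MeasureTheory ProbabilityTheory Filter Set
open scoped ENNReal NNReal Topology

theorem std_small : ∃ c : ℝ, 0 < c ∧ c ≤ 1 ∧ ∀ x : ℝ, 0 ≤ x → x ≤ 1 →
    c * x ≤ (gaussianReal 0 1).real {y | |y| ≤ x} := by
  set c0 : ℝ := gaussianPDFReal 0 1 1 with hc0
  have hc0p : 0 < c0 := gaussianPDFReal_pos 0 1 1 (by simp)
  refine ⟨min c0 1, by positivity, min_le_right _ _, fun x hx0 hx1 => ?_⟩
  have e : {y : ℝ | |y| ≤ x} = Icc (-x) x := by ext y; simp [abs_le]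
  have h1 : ENNReal.ofReal (c0 * (2 * x)) ≤ gaussianReal 0 1 {y | |y| ≤ x} := by
    rw [e, gaussianReal_apply 0 (by simp)]
    calc ENNReal.ofReal (c0 * (2 * x)) = ∫⁻ y in Icc (-x) x, ENNReal.ofReal c0 := by
          rw [setLIntegral_const, Real.volume_Icc, ENNReal.ofReal_mul hc0p.le]
          ring_nf
      _ ≤ _ := by
          refine setLIntegral_mono (by fun_prop) fun y hy => ?_
          rw [gaussianPDF]
          apply ENNReal.ofReal_le_ofReal
          rw [hc0, gaussianPDFReal, gaussianPDFReal]
          have : (y - 0)^2 ≤ (1 - 0)^2 := by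
            have : |y| ≤ 1 := (abs_le.2 hy).trans hx1
            rw [sub_zero, sub_zero, ← sq_abs]
            gcongr
          gcongr
  have h2 := ENNReal.toReal_mono (measure_ne_top _ _) h1
  rw [ENNReal.toReal_ofReal (by positivity)] at h2
  refine le_trans ?_ h2
  have : min c0 1 ≤ c0 := min_le_left _ _
  nlinarith

theorem std_large {p : ℝ} (hp : 0 < p) : ∃ C : ℝ, 0 < C ∧ ∀ x : ℝ, 0 < x →
    1 - C * x ^ (-p) ≤ (gaussianReal 0 1).real {y | |y| ≤ x} := by
  have hi : Integrable (fun y : ℝ => |y| ^ p) (gaussianReal 0 1) := by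
    have := memLp_id_gaussianReal' (μ := 0) (v := 1) (ENNReal.ofReal p) (by simp)
    have h2 := this.integrable_norm_rpow (by simpa using hp) (by simp)
    simpa [ENNReal.toReal_ofReal hp.le] using h2
  refine ⟨(∫ y, |y| ^ p ∂(gaussianReal 0 1)) + 1, ?_, fun x hx => ?_⟩
  · have : 0 ≤ ∫ y, |y| ^ p ∂(gaussianReal 0 1) := integral_nonneg fun y => by positivity
    positivity
  have hM := mul_meas_ge_le_integral_of_nonneg (ae_of_all _ fun y => by positivity) hi (x ^ p)
  have m : MeasurableSet {y : ℝ | |y| ≤ x} := measurableSet_le (by fun_prop) measurable_const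
  have hc := probReal_compl_eq_one_sub (μ := gaussianReal 0 1) m
  have hs : (gaussianReal 0 1).real {y : ℝ | |y| ≤ x}ᶜ ≤ (gaussianReal 0 1).real {y | x ^ p ≤ |y| ^ p} := by
    apply measureReal_mono _ (measure_ne_top _ _)
    intro y hy
    have : x ≤ |y| := by
      have : ¬ (|y| ≤ x) := hy
      linarith
    exact Real.rpow_le_rpow hx.le this hp.le
  have hxp : 0 < x ^ p := by positivity
  have hI : 0 ≤ (∫ y, |y| ^ p ∂(gaussianReal 0 1)) := integral_nonneg fun y => by positivity
  rw [Real.rpow_neg hx.le]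
  have h3 : (gaussianReal 0 1).real {y | x ^ p ≤ |y| ^ p} ≤ (∫ y, |y| ^ p ∂(gaussianReal 0 1)) * (x ^ p)⁻¹ := by
    rw [← div_eq_mul_inv, le_div_iff₀ hxp, mul_comm]
    exact hM
  have : 0 < (x ^ p)⁻¹ := by positivity
  nlinarith

theorem std_lower {p : ℝ} (hp : 0 < p) : ∃ C : ℝ, 0 < C ∧ ∀ x : ℝ, 0 < x →
    Real.exp (- (C * x ^ (-p))) ≤ (gaussianReal 0 1).real {y | |y| ≤ x} := by
  obtain ⟨c, c0, c1, hc⟩ := std_small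
  obtain ⟨C, C0, hC⟩ := std_large hp
  -- threshold
  set x0 : ℝ := max 1 ((2 * C) ^ (1 / p)) with hx0
  have hx01 : 1 ≤ x0 := le_max_left _ _
  have hx0p : 0 < x0 := by linarith
  have hx0C : 2 * C ≤ x0 ^ p := by
    calc 2 * C = ((2 * C) ^ (1 / p)) ^ p := by
          rw [← Real.rpow_mul (by positivity)]; field_simp; simp
      _ ≤ x0 ^ p := by
          apply Real.rpow_le_rpow (by positivity) (le_max_right _ _) hp.le
  set c' := c / x0 with hc'
  have c'0 : 0 < c' := by positivity
  have c'1 : c' ≤ 1 := by rw [hc', div_le_one hx0p]; linarith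
  have hlog : 0 ≤ - Real.log c' := by
    have := Real.log_nonpos c'0.le c'1
    linarith
  refine ⟨2 * C + (- Real.log c' * x0 ^ p + 1 / p), by positivity, fun x hx => ?_⟩
  have hxp : 0 < x ^ (-p) := by positivity
  have hA : 0 ≤ - Real.log c' * x0 ^ p + 1 / p := by positivity
  rcases le_total x x0 with h | h
  · have h1 : c' * x ≤ (gaussianReal 0 1).real {y | |y| ≤ x} := by
      have hmin : c * min x 1 ≤ (gaussianReal 0 1).real {y | |y| ≤ min x 1} :=
        hc _ (by positivity) (min_le_right _ _)
      have hmono : (gaussianReal 0 1).real {y : ℝ | |y| ≤ min x 1} ≤ (gaussianReal 0 1).real {y | |y| ≤ x} := by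
        apply measureReal_mono _ (measure_ne_top _ _)
        intro y hy
        have : |y| ≤ min x 1 := hy
        exact this.trans (min_le_left _ _)
      refine le_trans ?_ (hmin.trans hmono)
      rw [hc', div_mul_eq_mul_div, mul_div_assoc]
      gcongr
      refine le_min ?_ ?_
      · rw [div_le_iff₀ hx0p]; nlinarith
      · rw [div_le_one hx0p]; exact h
    refine le_trans ?_ h1
    rw [← Real.le_log_iff_exp_le (by positivity), Real.log_mul c'0.ne' hx.ne']
    have hlx : - Real.log x ≤ x ^ (-p) / p := by
      have := Real.log_le_rpow_div (x := x⁻¹) (ε := p) (by positivity) hp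
      rw [Real.log_inv, Real.inv_rpow hx.le, ← Real.rpow_neg hx.le] at this
      exact this
    have h2 : 1 ≤ x0 ^ p * x ^ (-p) := by
      rw [Real.rpow_neg hx.le, ← div_eq_mul_inv, one_le_div (by positivity)]
      exact Real.rpow_le_rpow hx.le h hp.le
    have h3 : - Real.log c' ≤ - Real.log c' * (x0 ^ p * x ^ (-p)) := le_mul_of_one_le_right hlog h2
    have : x ^ (-p) / p = 1 / p * x ^ (-p) := by ring
    nlinarith
  · refine le_trans ?_ (hC x hx)
    set y := C * x ^ (-p) with hy
    have hy0 : 0 < y := by positivity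
    have hy2 : y ≤ 1/2 := by
      rw [hy, Real.rpow_neg hx.le, ← div_eq_mul_inv, div_le_iff₀ (by positivity)]
      have := Real.rpow_le_rpow hx0p.le h hp.le
      linarith
    have h1 : Real.exp (-((2 * C + (- Real.log c' * x0 ^ p + 1 / p)) * x ^ (-p))) ≤ Real.exp (-(2 * y)) := by
      apply Real.exp_le_exp.2
      nlinarith
    refine h1.trans ?_
    -- elementary exponential bound
    have h2 : 1 + 2 * y ≤ Real.exp (2 * y) := by linarith [Real.add_one_le_exp (2 * y)]
    rw [Real.exp_neg, inv_le_comm₀ (Real.exp_pos _) (by linarith)]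
    refine le_trans ?_ h2
    rw [inv_le_iff_one_le_mul₀ (by linarith)]
    nlinarith

theorem gauss_lower {p : ℝ} (hp : 0 < p) : ∃ C : ℝ, 0 < C ∧ ∀ (v : ℝ≥0) (s b : ℝ), 0 < s → 0 < b →
    (v : ℝ) ≤ s ^ 2 → Real.exp (- (C * (b / s) ^ (-p))) ≤ (gaussianReal 0 v).real {y | |y| ≤ b} := by
  obtain ⟨C, C0, hC⟩ := std_lower hp
  refine ⟨C, C0, fun v s b hs hb hv => (hC _ (by positivity)).trans ?_⟩
  have e : gaussianReal 0 v = (gaussianReal 0 1).map (fun y => Real.sqrt v * y) := by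
    have := gaussianReal_map_const_mul (μ := 0) (v := 1) (Real.sqrt v)
    rw [this]
    congr 1
    · simp
    · ext; simp
  have m : MeasurableSet {y : ℝ | |y| ≤ b} := measurableSet_le (by fun_prop) measurable_const
  rw [e, map_measureReal_apply (by fun_prop) m]
  apply measureReal_mono _ (measure_ne_top _ _)
  intro y hy
  have h1 : |y| ≤ b / s := hy
  have h2 : Real.sqrt v ≤ s := Real.sqrt_le_iff.2 ⟨hs.le, hv⟩
  show |Real.sqrt v * y| ≤ b
  rw [abs_mul, abs_of_nonneg (Real.sqrt_nonneg _)]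
  rw [le_div_iff₀ hs] at h1
  calc Real.sqrt v * |y| ≤ s * |y| := by gcongr
    _ ≤ b := by linarith

open MeasureTheory ProbabilityTheory Filter Set
open scoped ENNReal NNReal Topology

theorem one_add_taylor (a : ℝ) (n : ℕ) : ∃ (b : ℕ → ℝ) (C δ : ℝ), 0 < C ∧ 0 < δ ∧ ∀ y : ℝ, |y| < δ →
    |(1 + y) ^ a - ∑ r ∈ Finset.range n, b r * y ^ r| ≤ C * |y| ^ n := by
  have h := (Real.one_add_rpow_hasFPowerSeriesAt_zero (a := a)).isBigO_sub_partialSum_pow n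
  obtain ⟨C, hC, h⟩ := h.exists_pos
  rw [Asymptotics.IsBigOWith, Metric.eventually_nhds_iff] at h
  obtain ⟨δ, hδ, h⟩ := h
  refine ⟨fun r => (binomialSeries ℝ a).coeff r, C, δ, hC, hδ, fun y hy => ?_⟩
  have := h (y := y) (by simpa using hy)
  simpa [FormalMultilinearSeries.partialSum, mul_comm] using this

section
variable {κ : Type*} [Fintype κ]

theorem far_bound {H : ℝ} {m : ℕ} {c x : κ → ℝ} (hx : ∀ k, x k ∈ Icc (0:ℝ) 1)
    (hm : ∀ r ≤ m, ∑ k, c k * x k ^ r = 0) : ∃ M C : ℝ, 1 ≤ M ∧ 0 ≤ C ∧ ∀ z, M ≤ z →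
      |∑ k, c k * RLK H (x k) (-z)| ≤ C * z ^ (H - 1/2 - (m + 1)) := by
  obtain ⟨b, C, δ, hC, hδ, h⟩ := one_add_taylor (H - 1/2) (m + 1)
  refine ⟨max 1 (2 / δ), (∑ k, |c k|) * C, le_max_left _ _, by positivity, fun z hz => ?_⟩
  have hz1 : 1 ≤ z := (le_max_left _ _).trans hz
  have hz2 : 2 / δ ≤ z := (le_max_right _ _).trans hz
  have hz0 : 0 < z := by linarith
  rw [div_le_iff₀ hδ] at hz2
  have e1 : ∀ k, RLK H (x k) (-z) = z ^ (H - 1/2) * (1 + x k / z) ^ (H - 1/2) := by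
    intro k
    have := (hx k).1
    rw [RLK, if_pos (by linarith), ← Real.mul_rpow hz0.le (by positivity)]
    congr 1
    field_simp
    ring
  have e2 : ∑ k, c k * RLK H (x k) (-z) = z ^ (H - 1/2) * ∑ k, c k * ((1 + x k / z) ^ (H - 1/2) -
      ∑ r ∈ Finset.range (m + 1), b r * (x k / z) ^ r) := by
    have e3 : ∑ k, c k * ∑ r ∈ Finset.range (m + 1), b r * (x k / z) ^ r = 0 := by
      simp_rw [Finset.mul_sum]
      rw [Finset.sum_comm]
      refine Finset.sum_eq_zero fun r hr => ?_
      have := hm r (by simpa [Nat.lt_succ_iff] using hr)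
      calc ∑ k, c k * (b r * (x k / z) ^ r) = b r / z ^ r * ∑ k, c k * x k ^ r := by
            rw [Finset.mul_sum]
            refine Finset.sum_congr rfl fun k _ => ?_
            rw [div_pow]; ring
        _ = 0 := by rw [this, mul_zero]
    simp_rw [mul_sub]
    rw [Finset.sum_sub_distrib, e3, sub_zero, Finset.mul_sum]
    refine Finset.sum_congr rfl fun k _ => ?_
    rw [e1]; ring
  rw [e2, abs_mul, abs_of_pos (by positivity : 0 < z ^ (H - 1/2)), Real.rpow_sub hz0 (H - 1/2) (m + 1)]
  have hb : |∑ k, c k * ((1 + x k / z) ^ (H - 1/2) -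
      ∑ r ∈ Finset.range (m + 1), b r * (x k / z) ^ r)| ≤ (∑ k, |c k|) * C * (1 / z ^ (m + 1)) := by
    refine (Finset.abs_sum_le_sum_abs _ _).trans ?_
    rw [Finset.sum_mul, Finset.sum_mul]
    refine Finset.sum_le_sum fun k _ => ?_
    rw [abs_mul, mul_assoc]
    have h0 := (hx k).1
    have h1 := (hx k).2
    have hy : |x k / z| = x k / z := abs_of_nonneg (by positivity)
    have hy2 : |x k / z| < δ := by
      rw [hy, div_lt_iff₀ hz0]; linarith
    refine mul_le_mul_of_nonneg_left ((h _ hy2).trans ?_) (abs_nonneg _)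
    rw [hy]
    refine mul_le_mul_of_nonneg_left ?_ hC.le
    rw [← one_div_pow]
    gcongr
  have hpz : 0 ≤ z ^ (H - 1/2) := by positivity
  refine (mul_le_mul_of_nonneg_left hb hpz).trans (le_of_eq ?_)
  have : z ^ ((m:ℝ) + 1) = z ^ (m + 1) := by
    rw [← Real.rpow_natCast]; push_cast; rfl
  rw [this]; ring

theorem RLK_shift (H t u M : ℝ) : RLK H (t + M) (u + M) = RLK H t u := by
  simp [RLK]

theorem comb_meas (H : ℝ) (c x : κ → ℝ) : Measurable (fun w => ∑ k, c k * RLK H (x k) w) := by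
  have := fun k => RLK_meas H (x k)
  fun_prop

theorem comb_int {H : ℝ} (hH : 0 < H) {m : ℕ} (hHm : H < m + 1) {c x : κ → ℝ}
    (hx : ∀ k, x k ∈ Icc (0:ℝ) 1)
    (hm : ∀ r ≤ m, ∑ k, c k * x k ^ r = 0) :
    IntegrableOn (fun w => (∑ k, c k * RLK H (x k) w) ^ 2) (Iic 1) := by
  obtain ⟨M, C, hM, hC, h⟩ := far_bound (H := H) hx hm
  have e : Iic (1:ℝ) = Iic (-M) ∪ Ioc (-M) 1 := by
    rw [Iic_union_Ioc_eq_Iic]; linarith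
  rw [e]
  refine IntegrableOn.union ?_ ?_
  · set p := 2 * (H - 1/2 - (m + 1)) with hp
    have h1 : IntegrableOn (fun z : ℝ => z ^ p) (Ici M) := by
      rw [integrableOn_Ici_iff_integrableOn_Ioi]
      exact integrableOn_Ioi_rpow_of_lt (by rw [hp]; linarith) (by linarith)
    have h2 : IntegrableOn (fun w : ℝ => C ^ 2 * (-w) ^ p) (Iic (-M)) := by
      have h3 := (MeasurePreserving.integrableOn_comp_preimage (Measure.measurePreserving_neg (volume : Measure ℝ))
        (Homeomorph.neg ℝ).measurableEmbedding).2 h1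
      have e : (Neg.neg ⁻¹' Ici M : Set ℝ) = Iic (-M) := by ext; simp
      rw [e] at h3
      exact h3.const_mul _
    refine Integrable.mono' h2 ((comb_meas H c x).pow_const 2).aestronglyMeasurable ?_
    refine (ae_restrict_iff' measurableSet_Iic).2 (ae_of_all _ fun w hw => ?_)
    have hw' : M ≤ -w := by
      have : w ≤ -M := hw
      linarith
    have := h (-w) hw'
    rw [neg_neg] at this
    rw [Real.norm_eq_abs, abs_pow]
    calc |∑ k, c k * RLK H (x k) w| ^ 2 ≤ (C * (-w) ^ (H - 1/2 - (m + 1))) ^ 2 := by gcongr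
      _ = C ^ 2 * (-w) ^ p := by
        rw [mul_pow, hp, ← Real.rpow_natCast ((-w) ^ (H - 1/2 - (m + 1) : ℝ)), ← Real.rpow_mul (by linarith)]
        congr 2
        push_cast; ring
  · have h1 : IntegrableOn (fun w => (∑ k, c k * RLK H (x k + M) w) ^ 2) (Ioc 0 (1 + M)) := by
      apply MemLp.integrable_sq
      refine memLp_finsetSum _ fun k _ => ?_
      exact (RLK_memLp hH (by linarith [(hx k).1]) _).const_mul _
    rw [← intervalIntegrable_iff_integrableOn_Ioc_of_le (by linarith)] at h1 ⊢
    have := h1.comp_add_right M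
    simp only [RLK_shift] at this
    convert this using 1 <;> ring

theorem var_bound {Ω : Type*} [MeasurableSpace Ω] {P : Measure Ω} {H : ℝ} {R : ℝ → Ω → ℝ}
    (hR : IsGaussianRL P R H) (hH : 0 < H) {m : ℕ} (hHm : H < m + 1) {c x : κ → ℝ}
    (hx : ∀ k, x k ∈ Icc (0:ℝ) 1)
    (hm : ∀ r ≤ m, ∑ k, c k * x k ^ r = 0) :
    ∃ C : ℝ, 0 < C ∧ ∀ s h : ℝ, 0 ≤ s → 0 < h →
      ∫ ω, (∑ k, c k * R (s + h * x k) ω) ^ 2 ∂P ≤ (C * h ^ H) ^ 2 := by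
  have hcomb := comb_int hH hHm hx hm
  set I := ∫ w in Iic 1, (∑ k, c k * RLK H (x k) w) ^ 2 with hI
  have hI0 : 0 ≤ I := integral_nonneg fun w => sq_nonneg _
  refine ⟨Real.sqrt I + 1, by positivity, fun s h hs hh => ?_⟩
  have hx0 : ∀ k, 0 ≤ s + h * x k := fun k => by
    have := (hx k).1
    positivity
  rw [hR.var hH (fun k => s + h * x k) (T := s + h * 1) hx0 (fun k => by
    have := (hx k).2
    gcongr), ← intervalIntegral.integral_of_le (by positivity)]
  have e0 : (0:ℝ) = s + h * (- s / h) := by field_simp; ring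
  rw [e0, ← intervalIntegral.mul_integral_comp_add_mul]
  have e1 : ∀ w k, RLK H (s + h * x k) (s + h * w) = h ^ (H - 1/2) * RLK H (x k) w := by
    intro w k
    by_cases hw : w ≤ x k
    · rw [RLK, RLK, if_pos hw, if_pos (by gcongr), ← Real.mul_rpow hh.le (by linarith)]
      congr 1; ring
    · rw [RLK, RLK, if_neg hw, if_neg, mul_zero]
      intro h'
      apply hw
      have : h * w ≤ h * x k := by linarith
      exact le_of_mul_le_mul_left this hh
  have e2 : ∀ w, (∑ k, c k * RLK H (s + h * x k) (s + h * w)) ^ 2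
      = (h ^ (H - 1/2)) ^ 2 * (∑ k, c k * RLK H (x k) w) ^ 2 := by
    intro w
    rw [← mul_pow, Finset.mul_sum]
    congr 1
    refine Finset.sum_congr rfl fun k _ => ?_
    rw [e1]; ring
  simp_rw [e2]
  rw [intervalIntegral.integral_const_mul, intervalIntegral.integral_of_le (by
    have : -s / h ≤ 0 := div_nonpos_of_nonpos_of_nonneg (by linarith) hh.le
    linarith)]
  have h3 : ∫ w in Ioc (-s / h) 1, (∑ k, c k * RLK H (x k) w) ^ 2 ≤ I :=
    setIntegral_mono_set hcomb (ae_of_all _ fun w => sq_nonneg _)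
      (LE.le.eventuallyLE Ioc_subset_Iic_self)
  have e4 : h * (h ^ (H - 1/2)) ^ 2 = (h ^ H) ^ 2 := by
    conv_lhs => rw [← Real.rpow_one h]
    rw [← Real.rpow_mul hh.le, ← Real.rpow_natCast, ← Real.rpow_natCast, ← Real.rpow_mul hh.le, ← Real.rpow_mul hh.le, ← Real.rpow_add hh]
    congr 1
    push_cast; ring
  have h5 : I ≤ (Real.sqrt I + 1) ^ 2 := by
    nlinarith [Real.sq_sqrt hI0, Real.sqrt_nonneg I]
  calc h * ((h ^ (H - 1/2)) ^ 2 * ∫ w in Ioc (-s / h) 1, (∑ k, c k * RLK H (x k) w) ^ 2)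
      = (h ^ H) ^ 2 * ∫ w in Ioc (-s / h) 1, (∑ k, c k * RLK H (x k) w) ^ 2 := by rw [← e4]; ring
    _ ≤ (h ^ H) ^ 2 * (Real.sqrt I + 1) ^ 2 := by
        gcongr
        exact h3.trans h5
    _ = _ := by ring
end

open MeasureTheory ProbabilityTheory Filter Set
open scoped ENNReal NNReal Topology

/-- equispaced nodes -/
noncomputable def nd (m : ℕ) (i : Fin (m + 1)) : ℝ := (i : ℝ) / m

/-- Lagrange basis functions -/
noncomputable def ell (m : ℕ) (i : Fin (m + 1)) (x : ℝ) : ℝ :=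
  (Lagrange.basis Finset.univ (nd m) i).eval x

/-- refinement nodes -/
noncomputable def rnd (m : ℕ) (q : Fin 2 × Fin (m + 1)) : ℝ := (((q.1 : ℕ) : ℝ) + nd m q.2) / 2

theorem nd_mem (m : ℕ) (hm : 1 ≤ m) (i : Fin (m + 1)) : nd m i ∈ Icc (0:ℝ) 1 := by
  have : (0:ℝ) < m := by exact_mod_cast hm
  refine ⟨by unfold nd; positivity, ?_⟩
  rw [nd, div_le_one this]
  exact_mod_cast Nat.lt_succ_iff.1 i.2

theorem rnd_mem (m : ℕ) (hm : 1 ≤ m) (q) : rnd m q ∈ Icc (0:ℝ) 1 := by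
  have h1 := nd_mem m hm q.2
  have h2 : ((q.1 : ℕ) : ℝ) ≤ 1 := by exact_mod_cast Nat.lt_succ_iff.1 q.1.2
  have h3 : (0:ℝ) ≤ ((q.1 : ℕ) : ℝ) := by positivity
  constructor
  · unfold rnd; linarith [h1.1]
  · unfold rnd; linarith [h1.2]

theorem ell_repr {m : ℕ} (hm : 1 ≤ m) {p : Polynomial ℝ} (hp : p.natDegree ≤ m) (x : ℝ) :
    p.eval x = ∑ i, p.eval (nd m i) * ell m i x := by
  have hm' : (m:ℝ) ≠ 0 := by positivity
  have inj : Set.InjOn (nd m) (Finset.univ : Finset (Fin (m + 1))) := by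
    intro i _ j _ hij
    simp only [nd] at hij
    field_simp at hij
    exact Fin.ext (by exact_mod_cast hij)
  have hd : p.degree < (Finset.univ : Finset (Fin (m + 1))).card := by
    rw [Finset.card_univ, Fintype.card_fin]
    exact lt_of_le_of_lt (Polynomial.degree_le_of_natDegree_le hp) (by exact_mod_cast Nat.lt_succ_self m)
  conv_lhs => rw [Lagrange.eq_interpolate inj hd]
  rw [Lagrange.interpolate_apply, Polynomial.eval_finsetSum]
  simp [ell]

theorem ell_pow {m : ℕ} (hm : 1 ≤ m) {r : ℕ} (hr : r ≤ m) (x : ℝ) :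
    x ^ r = ∑ i, nd m i ^ r * ell m i x := by
  have := ell_repr hm (p := Polynomial.X ^ r) (by simpa using hr) x
  simpa using this

theorem ell_bound (m : ℕ) : ∃ Λ : ℝ, 1 ≤ Λ ∧ ∀ x ∈ Icc (0:ℝ) 1, ∑ i, |ell m i x| ≤ Λ := by
  have hc : ContinuousOn (fun x => ∑ i, |ell m i x|) (Icc 0 1) := by
    unfold ell
    apply Continuous.continuousOn
    refine continuous_finsetSum _ fun i _ => ?_
    exact (Polynomial.continuous _).abs
  obtain ⟨Λ, hΛ⟩ := isCompact_Icc.exists_bound_of_continuousOn hc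
  refine ⟨max 1 Λ, le_max_left _ _, fun x hx => ?_⟩
  exact ((le_abs_self _).trans (hΛ x hx)).trans (le_max_right _ _)

/-- piecewise interpolation in normalized coordinates -/
noncomputable def itp (m : ℕ) (g : ℝ → ℝ) (x : ℝ) : ℝ := ∑ i, g (nd m i) * ell m i x

theorem itp_natDegree (m : ℕ) (hm : 1 ≤ m) (g : ℝ → ℝ) :
    ∃ p : Polynomial ℝ, p.natDegree ≤ m ∧ ∀ x, p.eval x = itp m g x := by
  refine ⟨Lagrange.interpolate Finset.univ (nd m) (fun i => g (nd m i)), ?_, fun x => ?_⟩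
  · have hm' : (m:ℝ) ≠ 0 := by positivity
    have inj : Set.InjOn (nd m) (Finset.univ : Finset (Fin (m + 1))) := by
      intro i _ j _ hij
      simp only [nd] at hij
      field_simp at hij
      exact Fin.ext (by exact_mod_cast hij)
    have := Lagrange.degree_interpolate_le (fun i => g (nd m i)) inj
    rw [Finset.card_univ, Fintype.card_fin, Nat.add_sub_cancel] at this
    exact Polynomial.natDegree_le_of_degree_le this
  · rw [Lagrange.interpolate_apply, Polynomial.eval_finsetSum]
    simp [ell, itp]

theorem itp_refine (m : ℕ) (hm : 1 ≤ m) (g : ℝ → ℝ) (e : Fin 2) (x : ℝ) :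
    itp m (fun x => g ((((e : ℕ) : ℝ) + x) / 2)) x = itp m g ((((e : ℕ) : ℝ) + x) / 2)
      + ∑ i, (g (rnd m (e, i)) - itp m g (rnd m (e, i))) * ell m i x := by
  obtain ⟨p, hp, hpe⟩ := itp_natDegree m hm g
  have := ell_repr hm (p := p.comp (Polynomial.C (1/2) * Polynomial.X + Polynomial.C (((e : ℕ) : ℝ) / 2)))
    (by
      refine Polynomial.natDegree_comp_le.trans ?_
      refine le_trans (Nat.mul_le_mul_left _ (Polynomial.natDegree_linear_le)) ?_
      simpa using hp) x
  simp only [Polynomial.eval_comp, Polynomial.eval_add, Polynomial.eval_mul, Polynomial.eval_C,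
    Polynomial.eval_X, hpe] at this
  have e1 : ∀ x : ℝ, 1 / 2 * x + ((e : ℕ) : ℝ) / 2 = (((e : ℕ) : ℝ) + x) / 2 := fun x => by ring
  simp only [e1] at this
  rw [this, ← Finset.sum_add_distrib, itp]
  refine Finset.sum_congr rfl fun i _ => ?_
  simp only [rnd]
  ring

theorem itp_chain {m : ℕ} (hm : 1 ≤ m) {Λ : ℝ} (hΛ : ∀ x ∈ Icc (0:ℝ) 1, ∑ i, |ell m i x| ≤ Λ)
    {f : ℝ → ℝ} {B : ℝ} {b : ℕ → ℝ} (hB : ∀ i, |f (nd m i)| ≤ B) (hB0 : 0 ≤ B) (hb0 : ∀ k, 0 ≤ b k)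
    (hb : ∀ k : ℕ, ∀ j : ℕ, j < 2 ^ k → ∀ q, |f (((j:ℝ) + rnd m q) / 2 ^ k)
      - itp m (fun x => f (((j:ℝ) + x) / 2 ^ k)) (rnd m q)| ≤ b k) (k : ℕ) :
    ∀ j : ℕ, j < 2 ^ k → ∀ x ∈ Icc (0:ℝ) 1, |itp m (fun x => f (((j:ℝ) + x) / 2 ^ k)) x|
      ≤ Λ * (B + ∑ i ∈ Finset.range k, b i) := by
  have gen : ∀ (a : Fin (m + 1) → ℝ) (M : ℝ), (∀ i, |a i| ≤ M) → 0 ≤ M → ∀ x ∈ Icc (0:ℝ) 1,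
      |∑ i, a i * ell m i x| ≤ Λ * M := by
    intro a M ha hM x hx
    refine (Finset.abs_sum_le_sum_abs _ _).trans ?_
    calc ∑ i, |a i * ell m i x| ≤ ∑ i, |ell m i x| * M := by
          refine Finset.sum_le_sum fun i _ => ?_
          rw [abs_mul, mul_comm]
          exact mul_le_mul_of_nonneg_left (ha i) (abs_nonneg _)
      _ ≤ Λ * M := by
          rw [← Finset.sum_mul]
          exact mul_le_mul_of_nonneg_right (hΛ x hx) hM
  induction k with
  | zero =>
    intro j hj x hx
    have : j = 0 := by simpa using hj
    subst this
    simp only [Finset.range_zero, Finset.sum_empty, add_zero]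
    refine gen _ B (fun i => ?_) hB0 x hx
    simpa using hB i
  | succ k ih =>
    intro j' hj' x hx
    set j := j' / 2 with hj
    set e : Fin 2 := ⟨j' % 2, Nat.mod_lt _ (by norm_num)⟩ with he
    have hjj : j' = 2 * j + (e : ℕ) := (Nat.div_add_mod j' 2).symm
    have hjk : j < 2 ^ k := by
      rw [pow_succ] at hj'
      omega
    have e1 : (fun x : ℝ => f (((j':ℝ) + x) / 2 ^ (k + 1)))
        = fun x => (fun x => f (((j:ℝ) + x) / 2 ^ k)) ((((e : ℕ) : ℝ) + x) / 2) := by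
      ext x
      simp only
      congr 1
      rw [hjj]
      push_cast
      field_simp
      ring
    have e2 := itp_refine m hm (fun x => f (((j:ℝ) + x) / 2 ^ k)) e x
    rw [e1, e2]
    have hx' : (((e : ℕ) : ℝ) + x) / 2 ∈ Icc (0:ℝ) 1 := by
      have h2 : ((e : ℕ) : ℝ) ≤ 1 := by exact_mod_cast Nat.lt_succ_iff.1 e.2
      have h3 : (0:ℝ) ≤ ((e : ℕ) : ℝ) := by positivity
      constructor <;> linarith [hx.1, hx.2]
    refine (abs_add_le _ _).trans ?_
    rw [Finset.sum_range_succ, ← add_assoc, mul_add]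
    refine add_le_add (ih j hjk _ hx') (gen _ _ (fun i => ?_) (hb0 k) x hx)
    exact hb k j hjk (e, i)

theorem chain_bound {m : ℕ} (hm : 1 ≤ m) {Λ : ℝ} (hΛ1 : 1 ≤ Λ)
    (hΛ : ∀ x ∈ Icc (0:ℝ) 1, ∑ i, |ell m i x| ≤ Λ)
    {f : ℝ → ℝ} (hf : ContinuousOn f (Icc 0 1)) {B S : ℝ} {b : ℕ → ℝ}
    (hB : ∀ i, |f (nd m i)| ≤ B) (hB0 : 0 ≤ B) (hb0 : ∀ k, 0 ≤ b k)
    (hS : ∀ k, ∑ i ∈ Finset.range k, b i ≤ S)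
    (hb : ∀ k : ℕ, ∀ j : ℕ, j < 2 ^ k → ∀ q, |f (((j:ℝ) + rnd m q) / 2 ^ k)
      - itp m (fun x => f (((j:ℝ) + x) / 2 ^ k)) (rnd m q)| ≤ b k) :
    ∀ t ∈ Icc (0:ℝ) 1, |f t| ≤ Λ * (B + S) := by
  intro t ht
  refine le_of_forall_pos_le_add fun η hη => ?_
  have huc := isCompact_Icc.uniformContinuousOn_of_continuous hf
  rw [Metric.uniformContinuousOn_iff] at huc
  obtain ⟨δ, hδ, huc⟩ := huc (η / Λ) (by positivity)
  obtain ⟨k, hk⟩ := exists_pow_lt_of_lt_one hδ (by norm_num : (1/2:ℝ) < 1)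
  have h2k : (0:ℝ) < 2 ^ k := by positivity
  -- the dyadic interval containing t
  obtain ⟨j, hj, x, hx, hxt⟩ : ∃ j : ℕ, j < 2 ^ k ∧ ∃ x ∈ Icc (0:ℝ) 1, t = ((j:ℝ) + x) / 2 ^ k := by
    rcases eq_or_lt_of_le ht.2 with h1 | h1
    · refine ⟨2 ^ k - 1, Nat.sub_lt (by positivity) one_pos, 1, ⟨zero_le_one, le_rfl⟩, ?_⟩
      rw [h1, Nat.cast_sub (Nat.one_le_two_pow)]
      push_cast
      field_simp
      ring
    · have h0 : 0 ≤ 2 ^ k * t := mul_nonneg h2k.le ht.1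
      refine ⟨⌊2 ^ k * t⌋₊, ?_, 2 ^ k * t - ⌊2 ^ k * t⌋₊, ⟨?_, ?_⟩, ?_⟩
      · rw [Nat.floor_lt h0]
        push_cast
        nlinarith
      · linarith [Nat.floor_le h0]
      · linarith [Nat.lt_floor_add_one (2 ^ k * t)]
      · field_simp
        ring
  have hc := itp_chain hm hΛ hB hB0 hb0 hb k j hj x hx
  have hsum : ∑ i, ell m i x = 1 := by
    have := ell_pow hm (Nat.zero_le m) x
    simpa using this.symm
  have hin : ∀ y ∈ Icc (0:ℝ) 1, ((j:ℝ) + y) / 2 ^ k ∈ Icc (0:ℝ) 1 := by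
    intro y hy
    have hj' : (j:ℝ) + 1 ≤ 2 ^ k := by exact_mod_cast hj
    refine ⟨div_nonneg (by linarith [hy.1, (Nat.cast_nonneg j : (0:ℝ) ≤ j)]) h2k.le, ?_⟩
    rw [div_le_one h2k]; linarith [hy.2]
  have hd : |f t - itp m (fun x => f (((j:ℝ) + x) / 2 ^ k)) x| ≤ η := by
    have e : f t - itp m (fun x => f (((j:ℝ) + x) / 2 ^ k)) x
        = ∑ i, (f t - f (((j:ℝ) + nd m i) / 2 ^ k)) * ell m i x := by
      simp_rw [sub_mul]
      rw [Finset.sum_sub_distrib, ← Finset.mul_sum, hsum, mul_one]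
      rfl
    rw [e]
    refine (Finset.abs_sum_le_sum_abs _ _).trans ?_
    calc ∑ i, |(f t - f (((j:ℝ) + nd m i) / 2 ^ k)) * ell m i x| ≤ ∑ i, |ell m i x| * (η / Λ) := by
          refine Finset.sum_le_sum fun i _ => ?_
          rw [abs_mul, mul_comm]
          refine mul_le_mul_of_nonneg_left ?_ (abs_nonneg _)
          have h1 := nd_mem m hm i
          refine (huc t ht _ (hin _ h1) ?_).le
          rw [hxt, Real.dist_eq, ← sub_div, abs_div, abs_of_pos h2k]
          have : |(j:ℝ) + x - (j + nd m i)| ≤ 1 := by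
            rw [abs_le]; constructor <;> linarith [hx.1, hx.2, h1.1, h1.2]
          calc _ ≤ 1 / 2 ^ k := by gcongr
            _ < δ := by rwa [← one_div_pow]
      _ ≤ Λ * (η / Λ) := by
          rw [← Finset.sum_mul]
          exact mul_le_mul_of_nonneg_right (hΛ x hx) (by positivity)
      _ = η := by field_simp
  have h3 : |f t| ≤ |itp m (fun x => f (((j:ℝ) + x) / 2 ^ k)) x| + η := by
    have := abs_sub_abs_le_abs_sub (f t) (itp m (fun x => f (((j:ℝ) + x) / 2 ^ k)) x)
    linarith
  refine h3.trans ?_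
  have : Λ * (B + ∑ i ∈ Finset.range k, b i) ≤ Λ * (B + S) := by
    have := hS k
    gcongr
  linarith

open MeasureTheory ProbabilityTheory Filter Set
open scoped ENNReal NNReal Topology

section lower
variable {Ω : Type*} [MeasurableSpace Ω] {P : Measure Ω} {R : ℝ → Ω → ℝ} {H : ℝ}

theorem IsGaussianRL.fam (hR : IsGaussianRL P R H) {I κ : Type*} [Fintype I] [Fintype κ]
    (c t : I → κ → ℝ) (ht : ∀ i o, 0 ≤ t i o) :
    CG P (fun i ω => ∑ o, c i o * R (t i o) ω) where
  meas i := by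
    have := hR.meas
    fun_prop
  gauss d := by
    obtain ⟨v, hv⟩ := (hR.cg (fun p : I × κ => t p.1 p.2) (fun p => ht _ _)).gauss
      (fun p => d p.1 * c p.1 p.2)
    refine ⟨v, ?_⟩
    rw [← hv]
    congr 1
    ext ω
    rw [Fintype.sum_prod_type]
    refine Finset.sum_congr rfl fun i _ => ?_
    rw [Finset.mul_sum]
    refine Finset.sum_congr rfl fun o _ => ?_
    ring

theorem CG.sidak_exp [IsProbabilityMeasure P] {I : Type*} [Fintype I] {Y : I → Ω → ℝ} (h : CG P Y)
    (b a : I → ℝ) (ha : ∀ i, ENNReal.ofReal (Real.exp (-(a i))) ≤ P {ω | |Y i ω| ≤ b i}) :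
    ENNReal.ofReal (Real.exp (-∑ i, a i)) ≤ P {ω | ∀ i, |Y i ω| ≤ b i} := by
  classical
  let e := Fintype.equivFin I
  have h' : CG P (fun k => Y (e.symm k)) := by
    refine ⟨fun i => h.meas _, fun c => ?_⟩
    obtain ⟨v, hv⟩ := h.gauss (fun i => c (e i))
    refine ⟨v, ?_⟩
    rw [← hv]
    congr 1
    ext ω
    rw [← e.symm.sum_comp (fun i => c (e i) * Y i ω)]
    simp
  have h2 := CG.sidak _ h' (fun k => b (e.symm k))
  have e1 : {ω | ∀ k, |Y (e.symm k) ω| ≤ b (e.symm k)} = {ω | ∀ i, |Y i ω| ≤ b i} := by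
    ext ω
    simp only [Set.mem_ofPred_eq]
    exact e.symm.forall_congr_right (q := fun i => |Y i ω| ≤ b i)
  rw [e1] at h2
  refine le_trans ?_ h2
  rw [e.symm.prod_comp (fun i => P {ω | |Y i ω| ≤ b i})]
  rw [← Finset.sum_neg_distrib, Real.exp_sum, ENNReal.ofReal_prod_of_nonneg (fun _ _ => (Real.exp_pos _).le)]
  exact Finset.prod_le_prod' fun i _ => ha i

theorem CG.single_lower [IsProbabilityMeasure P] {I : Type*} [Fintype I] {Y : I → Ω → ℝ} (h : CG P Y)
    {p C : ℝ} (hC : ∀ (v:ℝ≥0) (s b:ℝ), 0<s → 0<b → (v:ℝ) ≤ s^2 →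
      Real.exp (-(C*(b/s)^(-p))) ≤ (gaussianReal 0 v).real {y | |y| ≤ b})
    (i : I) {s b : ℝ} (hs : 0 < s) (hb : 0 < b) (hv : ∫ ω, (Y i ω) ^ 2 ∂P ≤ s ^ 2) :
    ENNReal.ofReal (Real.exp (-(C*(b/s)^(-p)))) ≤ P {ω | |Y i ω| ≤ b} := by
  obtain ⟨v, hY⟩ := h.single i
  have h1 := var_of_map (h.meas i) hY
  have h2 := hC v s b hs hb (by rw [← h1]; exact hv)
  have hm : MeasurableSet {y : ℝ | |y| ≤ b} := measurableSet_le (by fun_prop) (by fun_prop)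
  rw [← hY, measureReal_def, Measure.map_apply (h.meas i) hm] at h2
  exact ENNReal.ofReal_le_of_le_toReal h2

theorem geo_sum {a : ℝ} (ha : 0 < a) : ∃ M : ℝ, 0 < M ∧ ∀ k0 K : ℕ,
    ∑ k ∈ Finset.range K, (2:ℝ) ^ (-(a * |(k:ℝ) - k0|)) ≤ M := by
  set r : ℝ := 2 ^ (-a) with hr
  have r0 : 0 < r := by positivity
  have r1 : r < 1 := Real.rpow_lt_one_of_one_lt_of_neg (by norm_num) (by linarith)
  have hg : Summable (fun z : ℤ => r ^ z.natAbs) := by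
    refine Summable.of_nat_of_neg ?_ ?_
    · simpa using summable_geometric_of_lt_one r0.le r1
    · simpa using summable_geometric_of_lt_one r0.le r1
  refine ⟨∑' z : ℤ, r ^ z.natAbs + 1, ?_, fun k0 K => ?_⟩
  · have : 0 ≤ ∑' z : ℤ, r ^ z.natAbs := tsum_nonneg fun z => by positivity
    linarith
  have e : ∀ k : ℕ, (2:ℝ) ^ (-(a * |(k:ℝ) - k0|)) = r ^ ((k:ℤ) - k0).natAbs := by
    intro k
    rw [hr, ← Real.rpow_natCast, ← Real.rpow_mul (by norm_num), Nat.cast_natAbs]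
    push_cast
    congr 1
    ring
  simp_rw [e]
  have inj : Function.Injective (fun k : ℕ => (k:ℤ) - k0) := by
    intro x y hxy
    simp at hxy
    exact hxy
  have h1 : ∑ k ∈ Finset.range K, r ^ ((k:ℤ) - k0).natAbs
      = ∑ z ∈ (Finset.range K).map ⟨_, inj⟩, r ^ z.natAbs := by
    rw [Finset.sum_map]; rfl
  rw [h1]
  have := hg.sum_le_tsum ((Finset.range K).map ⟨_, inj⟩) (fun z _ => by positivity)
  linarith

/-- coefficients of the refinement functional -/
noncomputable def dc (m : ℕ) (q : Fin 2 × Fin (m + 1)) : Option (Fin (m + 1)) → ℝ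
  | none => 1
  | some l => - ell m l (rnd m q)

/-- nodes of the refinement functional -/
noncomputable def dx (m : ℕ) (q : Fin 2 × Fin (m + 1)) : Option (Fin (m + 1)) → ℝ
  | none => rnd m q
  | some l => nd m l

theorem dx_mem {m : ℕ} (hm : 1 ≤ m) (q o) : dx m q o ∈ Icc (0:ℝ) 1 := by
  cases o with
  | none => exact rnd_mem m hm q
  | some l => exact nd_mem m hm l

theorem dc_moment {m : ℕ} (hm : 1 ≤ m) (q) : ∀ r ≤ m, ∑ o, dc m q o * dx m q o ^ r = 0 := by
  intro r hr
  rw [Fintype.sum_option]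
  simp only [dc, dx, one_mul]
  rw [ell_pow hm hr (rnd m q), ← Finset.sum_add_distrib]
  refine Finset.sum_eq_zero fun i _ => ?_
  ring

theorem dc_eq (m : ℕ) (q) (f : ℝ → ℝ) (s h : ℝ) :
    ∑ o, dc m q o * f (s + h * dx m q o)
      = f (s + h * rnd m q) - itp m (fun x => f (s + h * x)) (rnd m q) := by
  rw [Fintype.sum_option]
  simp only [dc, dx, one_mul, itp]
  rw [sub_eq_add_neg, ← Finset.sum_neg_distrib]
  congr 1
  refine Finset.sum_congr rfl fun i _ => ?_
  ring

/-- coefficients and nodes of all functionals up to level K -/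
noncomputable def fc (m K : ℕ) :
    (Fin (m + 1) ⊕ (Σ k : Fin K, Fin (2 ^ (k:ℕ)) × (Fin 2 × Fin (m + 1)))) → Option (Fin (m + 1)) → ℝ
  | .inl _, none => 1
  | .inl _, some _ => 0
  | .inr i, o => dc m i.2.2 o

/-- nodes of all functionals up to level K -/
noncomputable def ft (m K : ℕ) :
    (Fin (m + 1) ⊕ (Σ k : Fin K, Fin (2 ^ (k:ℕ)) × (Fin 2 × Fin (m + 1)))) → Option (Fin (m + 1)) → ℝ
  | .inl i, _ => nd m i
  | .inr i, o => ((i.2.1 : ℕ) : ℝ) / 2 ^ (i.1 : ℕ) + (1 / 2 ^ (i.1 : ℕ)) * dx m i.2.2 o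

theorem ft_nonneg {m : ℕ} (hm : 1 ≤ m) (K : ℕ) (i o) : 0 ≤ ft m K i o := by
  cases i with
  | inl i => exact (nd_mem m hm i).1
  | inr i =>
    have := (dx_mem hm i.2.2 o).1
    simp only [ft]
    positivity

theorem rpow_calc {H c σ κ κ0 : ℝ} (hH : 0 < H) (hc : 0 < c) (hσ : 0 < σ) :
    ∃ p ∈ ({3 / H, 1 / (3 * H)} : Set ℝ),
      (c * 2 ^ (-(κ0 * H)) * 2 ^ (-(H / 2 * |κ - κ0|)) / (σ * 2 ^ (-(κ * H)))) ^ (-p)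
      = (c / σ) ^ (-p) * ((2:ℝ) ^ κ0 * 2 ^ (-(1 / 2 * |κ - κ0|)) / 2 ^ κ) := by
  have h2 : (0:ℝ) < 2 := by norm_num
  have e1 : c * (2:ℝ) ^ (-(κ0 * H)) * 2 ^ (-(H / 2 * |κ - κ0|)) / (σ * 2 ^ (-(κ * H)))
      = (c / σ) * 2 ^ (-(κ0 * H) + -(H / 2 * |κ - κ0|) - -(κ * H)) := by
    rw [Real.rpow_sub h2, Real.rpow_add h2]
    have := (Real.rpow_pos_of_pos h2 (-(κ * H))).ne'
    field_simp
  have e2 : (2:ℝ) ^ κ0 * 2 ^ (-(1 / 2 * |κ - κ0|)) / 2 ^ κ = 2 ^ (κ0 + -(1 / 2 * |κ - κ0|) - κ) := by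
    rw [Real.rpow_sub h2, Real.rpow_add h2]
  rw [e1, e2]
  have key : ∀ p, (-(κ0 * H) + -(H / 2 * |κ - κ0|) - -(κ * H)) * (-p) = (κ0 + -(1 / 2 * |κ - κ0|) - κ) →
     ((c / σ) * (2:ℝ) ^ (-(κ0 * H) + -(H / 2 * |κ - κ0|) - -(κ * H))) ^ (-p)
       = (c / σ) ^ (-p) * 2 ^ (κ0 + -(1 / 2 * |κ - κ0|) - κ) := by
    intro p hp
    rw [Real.mul_rpow (by positivity) (by positivity), ← Real.rpow_mul h2.le, hp]
  rcases le_total κ0 κ with h | h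
  · refine ⟨3 / H, by simp, key _ ?_⟩
    rw [abs_of_nonneg (by linarith)]
    field_simp
    ring
  · refine ⟨1 / (3 * H), by simp, key _ ?_⟩
    rw [abs_of_nonpos (by linarith)]
    field_simp
    ring

theorem IsGaussianRL.lower [IsProbabilityMeasure P] (hR : IsGaussianRL P R H) (hH : 0 < H)
    (hcont : ∀ ω, ContinuousOn (fun t => R t ω) (Icc 0 1)) :
    ∃ C : ℝ, 0 < C ∧ ∀ k0 : ℕ, ENNReal.ofReal (Real.exp (-(C * 2 ^ k0)))
      ≤ smallBall P R (2 ^ (-((k0:ℝ) * H))) := by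
  obtain ⟨m, hm, hHm⟩ : ∃ m : ℕ, 1 ≤ m ∧ H < m + 1 := by
    obtain ⟨n, hn⟩ := exists_nat_gt H
    refine ⟨n + 1, by omega, ?_⟩
    push_cast
    linarith
  obtain ⟨Λ, hΛ1, hΛ⟩ := ell_bound m
  obtain ⟨M1, hM1, hgeo1⟩ := geo_sum (a := H / 2) (by positivity)
  obtain ⟨M2, hM2, hgeo2⟩ := geo_sum (a := 1 / 2) (by positivity)
  obtain ⟨C1, hC1, hg1⟩ := gauss_lower (p := 3 / H) (by positivity)
  obtain ⟨C2, hC2, hg2⟩ := gauss_lower (p := 1 / (3 * H)) (by positivity)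
  obtain ⟨C3, hC3, hg3⟩ := gauss_lower (p := 1 / H) (by positivity)
  have hvar := fun q => var_bound hR hH hHm (dx_mem hm q) (dc_moment hm q)
  choose σq hσq hvar using hvar
  set σ : ℝ := ∑ q, σq q with hσ
  have hσle : ∀ q, σq q ≤ σ := fun q =>
    Finset.single_le_sum (f := σq) (fun q _ => (hσq q).le) (Finset.mem_univ q)
  have hσ0 : 0 < σ := lt_of_lt_of_le (hσq (0, 0)) (hσle _)
  set τ : Fin (m + 1) → ℝ := fun i => 1 + ∫ ω, R (nd m i) ω ^ 2 ∂P with hτ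
  have hτ0 : ∀ i, 1 ≤ τ i := fun i => by
    have : 0 ≤ ∫ ω, R (nd m i) ω ^ 2 ∂P := integral_nonneg fun ω => sq_nonneg _
    simp only [hτ]; linarith
  set c : ℝ := 1 / (Λ * (1 + M1)) with hc
  have hc0 : 0 < c := by positivity
  set D : ℝ := C1 * (c / σ) ^ (-(3 / H)) + C2 * (c / σ) ^ (-(1 / (3 * H))) with hD
  have hD0 : 0 < D := by positivity
  set D3 : ℝ := ∑ i, C3 * (c / τ i) ^ (-(1 / H)) with hD3
  have hD30 : 0 < D3 := by
    refine Finset.sum_pos (fun i _ => ?_) Finset.univ_nonempty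
    have := hτ0 i
    positivity
  refine ⟨D3 + D * (2 * (m + 1)) * M2, by positivity, fun k0 => ?_⟩
  set B : ℝ := c * 2 ^ (-((k0:ℝ) * H)) with hB
  have hB0 : 0 < B := by positivity
  set b : ℕ → ℝ := fun k => B * 2 ^ (-(H / 2 * |(k:ℝ) - k0|)) with hb
  have hb0 : ∀ k, 0 < b k := fun k => by positivity
  set a : ℕ → ℝ := fun k => D * (2 ^ k0 * 2 ^ (-(1 / 2 * |(k:ℝ) - k0|)) / 2 ^ k) with ha
  -- finite level
  have fin : ∀ K : ℕ, ENNReal.ofReal (Real.exp (-((D3 + D * (2 * (m + 1)) * M2) * 2 ^ k0)))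
      ≤ P {ω | (∀ i, |R (nd m i) ω| ≤ B) ∧ ∀ k < K, ∀ j : ℕ, j < 2 ^ k → ∀ q,
        |∑ o, dc m q o * R ((j:ℝ) / 2 ^ k + (1 / 2 ^ k) * dx m q o) ω| ≤ b k} := by
    intro K
    have hcg := hR.fam (fc m K) (ft m K) (ft_nonneg hm K)
    have hs := hcg.sidak_exp (Sum.elim (fun _ => B) (fun i => b i.1))
      (Sum.elim (fun i => C3 * (c / τ i) ^ (-(1 / H)) * 2 ^ k0) (fun i => a i.1)) (by
        rintro (i | ⟨k, j, q⟩)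
        · have h1 := hcg.single_lower hg3 (.inl i) (s := τ i) (b := B) (by linarith [hτ0 i]) hB0 (by
            have e : ∀ ω, ∑ o, fc m K (.inl i) o * R (ft m K (.inl i) o) ω = R (nd m i) ω := by
              intro ω
              rw [Fintype.sum_option]
              simp [fc, ft]
            simp only [e]
            have := hτ0 i
            have h3 : ∫ ω, R (nd m i) ω ^ 2 ∂P = τ i - 1 := by simp [hτ]
            rw [h3]
            nlinarith)
          refine le_trans (le_of_eq ?_) h1
          congr 3
          simp only [Sum.elim_inl]
          have := hτ0 i
          rw [hB, mul_div_right_comm, Real.mul_rpow (by positivity) (by positivity),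
            ← Real.rpow_mul (by norm_num), mul_assoc]
          congr 2
          rw [← Real.rpow_natCast]
          congr 1
          field_simp
        · obtain ⟨p, hp, hcalc⟩ := rpow_calc (κ := (k:ℕ)) (κ0 := k0) hH hc0 hσ0
          have hs0 : 0 < σ * (2:ℝ) ^ (-(((k:ℕ):ℝ) * H)) := by positivity
          have hv : ∫ ω, (∑ o, fc m K (.inr ⟨k, j, q⟩) o * R (ft m K (.inr ⟨k, j, q⟩) o) ω) ^ 2 ∂P
              ≤ (σ * (2:ℝ) ^ (-(((k:ℕ):ℝ) * H))) ^ 2 := by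
            refine (hvar q (((j:ℕ):ℝ) / 2 ^ (k:ℕ)) (1 / 2 ^ (k:ℕ)) (by positivity) (by positivity)).trans ?_
            have e : (1 / (2:ℝ) ^ (k:ℕ)) ^ H = 2 ^ (-(((k:ℕ):ℝ) * H)) := by
              rw [one_div, ← Real.rpow_natCast, ← Real.rpow_neg (by norm_num), ← Real.rpow_mul (by norm_num), neg_mul]
            rw [e]
            have := hσle q
            have := (hσq q).le
            gcongr
          simp only [Sum.elim_inr]
          have fin1 : ∀ p C : ℝ, 0 < C → C * (c / σ) ^ (-p) ≤ D → (∀ (v:ℝ≥0) (s b:ℝ), 0<s → 0<b → (v:ℝ) ≤ s^2 →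
                Real.exp (-(C*(b/s)^(-p))) ≤ (gaussianReal 0 v).real {y | |y| ≤ b}) →
              (c * 2 ^ (-((k0:ℝ) * H)) * 2 ^ (-(H / 2 * |((k:ℕ):ℝ) - k0|)) / (σ * 2 ^ (-(((k:ℕ):ℝ) * H)))) ^ (-p)
                = (c / σ) ^ (-p) * ((2:ℝ) ^ (k0:ℝ) * 2 ^ (-(1 / 2 * |((k:ℕ):ℝ) - k0|)) / 2 ^ ((k:ℕ):ℝ)) →
              ENNReal.ofReal (Real.exp (-(a k))) ≤ P {ω | |∑ o, fc m K (.inr ⟨k, j, q⟩) o * R (ft m K (.inr ⟨k, j, q⟩) o) ω| ≤ b k} := by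
            intro p C hC hCD hg hcalc
            have h1 := hcg.single_lower hg (.inr ⟨k, j, q⟩) hs0 (hb0 k) hv
            refine le_trans ?_ h1
            apply ENNReal.ofReal_le_ofReal
            apply Real.exp_le_exp.2
            apply neg_le_neg
            rw [hb, hB, hcalc, ← mul_assoc, Real.rpow_natCast, Real.rpow_natCast]
            exact mul_le_mul_of_nonneg_right hCD (by positivity)
          rcases hp with rfl | hp
          · refine fin1 _ C1 hC1 ?_ hg1 hcalc
            rw [hD]
            have : 0 < C2 * (c / σ) ^ (-(1 / (3 * H))) := by positivity
            linarith
          · rw [Set.mem_singleton_iff] at hp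
            subst hp
            refine fin1 _ C2 hC2 ?_ hg2 hcalc
            rw [hD]
            have : 0 < C1 * (c / σ) ^ (-(3 / H)) := by positivity
            linarith)
    refine le_trans (ENNReal.ofReal_le_ofReal (Real.exp_le_exp.2 (neg_le_neg ?_))) (hs.trans (measure_mono ?_))
    · rw [Fintype.sum_sum_type]
      simp only [Sum.elim_inl, Sum.elim_inr]
      rw [← Finset.sum_mul, ← hD3, Fintype.sum_sigma, add_mul]
      refine add_le_add le_rfl ?_
      simp only [Finset.sum_const, Finset.card_univ, Fintype.card_prod, Fintype.card_fin, nsmul_eq_mul]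
      rw [Fin.sum_univ_eq_sum_range (fun k => ((2 ^ k * (2 * (m + 1)) : ℕ) : ℝ) * a k) K]
      have e : ∀ k : ℕ, ((2 ^ k * (2 * (m + 1)) : ℕ) : ℝ) * a k
          = D * (2 * (m + 1)) * 2 ^ k0 * 2 ^ (-(1 / 2 * |(k:ℝ) - k0|)) := by
        intro k
        simp only [ha]
        push_cast
        field_simp
      simp_rw [e]
      rw [← Finset.mul_sum]
      have := mul_le_mul_of_nonneg_left (hgeo2 k0 K) (show 0 ≤ D * (2 * (m + 1)) * 2 ^ k0 by positivity)
      linarith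
    · intro ω hω
      simp only [Set.mem_ofPred_eq] at hω ⊢
      refine ⟨fun i => ?_, fun k hk j hj q => ?_⟩
      · have := hω (.inl i)
        rw [Fintype.sum_option] at this
        simpa [fc, ft] using this
      · exact hω (.inr ⟨⟨k, hk⟩, ⟨j, hj⟩, q⟩)
  -- passage to the limit
  set E : ℕ → Set Ω := fun K => {ω | (∀ i, |R (nd m i) ω| ≤ B) ∧ ∀ k < K, ∀ j : ℕ, j < 2 ^ k → ∀ q,
        |∑ o, dc m q o * R ((j:ℝ) / 2 ^ k + (1 / 2 ^ k) * dx m q o) ω| ≤ b k} with hE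
  have hmeas : ∀ K, MeasurableSet (E K) := by
    intro K
    have := hR.meas
    simp only [hE]
    measurability
  have hanti : Antitone E := by
    intro K K' hK ω hω
    exact ⟨hω.1, fun k hk => hω.2 k (hk.trans_le hK)⟩
  have hlim := tendsto_measure_iInter_atTop (μ := P) (fun K => (hmeas K).nullMeasurableSet) hanti ⟨0, measure_ne_top _ _⟩
  have h1 := ge_of_tendsto' hlim fin
  refine h1.trans (measure_mono ?_)
  intro ω hω
  rw [Set.mem_iInter] at hω
  have hcb := chain_bound hm hΛ1 hΛ (hcont ω) (B := B) (S := B * M1) (b := b) (hω 0).1 hB0.le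
    (fun k => (hb0 k).le) (fun K => by
      simp only [hb]
      rw [← Finset.mul_sum]
      exact mul_le_mul_of_nonneg_left (hgeo1 k0 K) hB0.le) (by
      intro k j hj q
      have h2 := (hω (k + 1)).2 k (Nat.lt_succ_self k) j hj q
      rw [dc_eq m q (fun t => R t ω)] at h2
      have e : ∀ x : ℝ, (j:ℝ) / 2 ^ k + 1 / 2 ^ k * x = (j + x) / 2 ^ k := fun x => by ring
      simpa only [e] using h2)
  intro t ht
  refine (hcb t ht).trans (le_of_eq ?_)
  rw [hB, hc]
  field_simp

end lower

open MeasureTheory ProbabilityTheory Filter Set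
open scoped ENNReal NNReal Topology

section assembly
variable {Ω : Type*} [MeasurableSpace Ω] {P : Measure Ω} {R : ℝ → Ω → ℝ} {H : ℝ}

theorem smallBall_mono {ε ε' : ℝ} (h : ε ≤ ε') : smallBall P R ε ≤ smallBall P R ε' :=
  measure_mono fun _ hω t ht => (hω t ht).trans h

theorem IsGaussianRL.var_one_pos [IsProbabilityMeasure P] (hR : IsGaussianRL P R H) (hH : 0 < H) :
    0 < ∫ ω, R 1 ω * R 1 ω ∂P := by
  rw [hR.covK (T := 1) zero_le_one zero_le_one (by simp),
    ← intervalIntegral.integral_of_le zero_le_one]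
  refine intervalIntegral.intervalIntegral_pos_of_pos_on ?_ ?_ zero_lt_one
  · rw [intervalIntegrable_iff_integrableOn_Ioc_of_le zero_le_one]
    exact RLK_int hH zero_le_one zero_le_one 1
  · intro u hu
    have : 0 < 1 - u := by linarith [hu.2]
    simp only [RLK, hu.2.le, if_true]
    positivity

theorem IsGaussianRL.one_lt_one [IsProbabilityMeasure P] (hR : IsGaussianRL P R H) (hH : 0 < H) :
    smallBall P R 1 < 1 := by
  have hcg := hR.cg (fun _ : Fin 1 => (1:ℝ)) (fun _ => zero_le_one)
  obtain ⟨v, hv⟩ := hcg.single 0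
  have h1 := var_of_map (hR.meas 1) hv
  have hv0 : v ≠ 0 := by
    rintro rfl
    have := hR.var_one_pos hH
    simp only [pow_two] at h1
    rw [h1] at this
    simp at this
  have hm : MeasurableSet {y : ℝ | |y| ≤ 1} := measurableSet_le (by fun_prop) (by fun_prop)
  have hle : smallBall P R 1 ≤ gaussianReal 0 v {y : ℝ | |y| ≤ 1} := by
    rw [← hv, Measure.map_apply (hR.meas 1) hm]
    exact measure_mono fun ω hω => hω 1 ⟨zero_le_one, le_rfl⟩
  refine lt_of_le_of_lt hle (lt_of_le_of_ne prob_le_one fun heq => ?_)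
  have h2 : gaussianReal 0 v {y : ℝ | |y| ≤ 1}ᶜ = 0 := by
    rw [prob_compl_eq_zero_iff hm]; exact heq
  have h3 := gaussianReal_absolutelyContinuous' 0 hv0 h2
  have ho : IsOpen ({y : ℝ | |y| ≤ 1}ᶜ) := (isClosed_le (by fun_prop) (by fun_prop)).isOpen_compl
  have hne : ({y : ℝ | |y| ≤ 1}ᶜ).Nonempty := ⟨2, by simp⟩
  exact (ho.measure_pos volume hne).ne' h3

theorem IsGaussianRL.limit [IsProbabilityMeasure P] (hR : IsGaussianRL P R H) (hH : 0 < H)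
    (hcont : ∀ ω, ContinuousOn (fun t => R t ω) (Icc 0 1)) :
    ∃ K : ℝ, 0 < K ∧ Tendsto (fun ε : ℝ => ε ^ (1 / H) * Real.log (smallBall P R ε).toReal)
      (𝓝[>] 0) (𝓝 (-K)) := by
  have hfin : ∀ ε, smallBall P R ε ≠ ∞ := fun ε => measure_ne_top _ _
  obtain ⟨C, hC, hlow⟩ := hR.lower hH hcont
  set g : ℝ → ℝ := fun x => Real.log (smallBall P R (x ^ (-H))).toReal with hg
  have hnear : ∀ x : ℝ, 0 < x → ∃ k0 : ℕ, x ≤ 2 ^ k0 ∧ (1 ≤ x → (2:ℝ) ^ k0 ≤ 2 * x) := by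
    intro x hx
    rcases le_total 1 x with h | h
    · obtain ⟨n, hn, hn'⟩ := exists_nat_pow_near h (by norm_num : (1:ℝ) < 2)
      refine ⟨n + 1, hn'.le, fun _ => ?_⟩
      rw [pow_succ]; linarith
    · exact ⟨0, by simpa using h, fun h' => by simp; linarith⟩
  have hlow' : ∀ x : ℝ, 0 < x → ∀ k0 : ℕ, x ≤ 2 ^ k0 →
      Real.exp (-(C * 2 ^ k0)) ≤ (smallBall P R (x ^ (-H))).toReal := by
    intro x hx k0 hk
    have h1 : (2:ℝ) ^ (-((k0:ℝ) * H)) ≤ x ^ (-H) := by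
      rw [neg_mul_eq_mul_neg, Real.rpow_mul (by norm_num), Real.rpow_natCast]
      exact Real.rpow_le_rpow_of_nonpos hx hk (by linarith)
    have h2 := (hlow k0).trans (smallBall_mono h1)
    exact (ENNReal.ofReal_le_iff_le_toReal (hfin _)).1 h2
  have hpos : ∀ x : ℝ, 0 < x → 0 < (smallBall P R (x ^ (-H))).toReal := by
    intro x hx
    obtain ⟨k0, hk, -⟩ := hnear x hx
    exact (Real.exp_pos _).trans_le (hlow' x hx k0 hk)
  have hbd : ∀ x : ℝ, 1 ≤ x → -(2 * C) * x ≤ g x := by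
    intro x hx
    obtain ⟨k0, hk, hk'⟩ := hnear x (by linarith)
    have h1 := hlow' x (by linarith) k0 hk
    have h2 := (Real.le_log_iff_exp_le (hpos x (by linarith))).2 h1
    have := hk' hx
    simp only [hg]
    nlinarith
  have hanti : ∀ x y : ℝ, 0 < x → x ≤ y → g y ≤ g x := by
    intro x y hx hxy
    refine Real.log_le_log (hpos y (by linarith)) (ENNReal.toReal_mono (hfin _) (smallBall_mono ?_))
    exact Real.rpow_le_rpow_of_nonpos hx hxy (by linarith)
  have hsub : ∀ x y : ℝ, 0 < x → 0 < y → g (x + y) ≤ g x + g y := by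
    intro x y hx hy
    have hxy : 0 < x + y := by positivity
    have h1 := hR.submul hH hcont (τ := x / (x + y)) (by positivity)
      (by rw [div_lt_one hxy]; linarith) ((x + y) ^ (-H))
    have e1 : (1:ℝ) - x / (x + y) = y / (x + y) := by field_simp; ring
    rw [e1, ← Real.mul_rpow hxy.le (by positivity), ← Real.mul_rpow hxy.le (by positivity),
      mul_div_cancel₀ _ hxy.ne', mul_div_cancel₀ _ hxy.ne'] at h1
    have h2 := ENNReal.toReal_mono (ENNReal.mul_ne_top (hfin _) (hfin _)) h1
    rw [ENNReal.toReal_mul] at h2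
    simp only [hg]
    rw [← Real.log_mul (hpos x hx).ne' (hpos y hy).ne']
    exact Real.log_le_log (hpos _ hxy) h2
  have hg1 : g 1 < 0 := by
    refine Real.log_neg (hpos 1 one_pos) ?_
    rw [Real.one_rpow]
    have := (ENNReal.toReal_lt_toReal (hfin 1) ENNReal.one_ne_top).2 (hR.one_lt_one hH)
    simpa using this
  set v : ℕ → ℝ := fun n => if n = 0 then 0 else g n with hv
  have hv' : ∀ n, 1 ≤ n → v n = g n := fun n hn => by simp only [hv]; rw [if_neg (by omega)]
  have hvsub : Subadditive v := by
    intro a b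
    rcases Nat.eq_zero_or_pos a with rfl | ha
    · simp [hv]
    rcases Nat.eq_zero_or_pos b with rfl | hb
    · simp [hv]
    rw [hv' _ ha, hv' _ hb, hv' _ (by omega)]
    push_cast
    exact hsub _ _ (by exact_mod_cast ha) (by exact_mod_cast hb)
  have hbdd : BddBelow (range fun n => v n / n) := by
    refine ⟨-(2 * C), ?_⟩
    rintro _ ⟨n, rfl⟩
    rcases Nat.eq_zero_or_pos n with rfl | hn
    · simp; positivity
    · have hn' : (1:ℝ) ≤ n := by exact_mod_cast hn
      simp only
      rw [hv' n hn, le_div_iff₀ (by linarith)]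
      exact hbd n hn'
  have hlim := hvsub.tendsto_lim hbdd
  have hL : hvsub.lim < 0 := by
    have := hvsub.lim_le_div hbdd (n := 1) one_ne_zero
    rw [hv' 1 le_rfl] at this
    simp only [Nat.cast_one, div_one] at this
    linarith
  refine ⟨-hvsub.lim, by linarith, ?_⟩
  rw [neg_neg]
  have hreal : Tendsto (fun x : ℝ => g x / x) atTop (𝓝 hvsub.lim) := by
    have l1 : Tendsto (fun x : ℝ => v ⌈x⌉₊ / (⌈x⌉₊ : ℝ) * ((⌈x⌉₊ : ℝ) / x)) atTop (𝓝 (hvsub.lim * 1)) :=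
      (hlim.comp tendsto_nat_ceil_atTop).mul (tendsto_nat_ceil_div_atTop (R := ℝ))
    have l2 : Tendsto (fun x : ℝ => v ⌊x⌋₊ / (⌊x⌋₊ : ℝ) * ((⌊x⌋₊ : ℝ) / x)) atTop (𝓝 (hvsub.lim * 1)) :=
      (hlim.comp tendsto_nat_floor_atTop).mul (tendsto_nat_floor_div_atTop (R := ℝ))
    rw [mul_one] at l1 l2
    refine tendsto_of_tendsto_of_tendsto_of_le_of_le' l1 l2 ?_ ?_
    · filter_upwards [eventually_ge_atTop 1] with x hx
      have hc : 1 ≤ ⌈x⌉₊ := Nat.one_le_ceil_iff.2 (by linarith)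
      have hc' : (0:ℝ) < ⌈x⌉₊ := by exact_mod_cast hc
      rw [hv' _ hc, div_mul_div_cancel₀ hc'.ne']
      have := hanti x ⌈x⌉₊ (by linarith) (Nat.le_ceil x)
      gcongr
    · filter_upwards [eventually_ge_atTop 1] with x hx
      have hc : 1 ≤ ⌊x⌋₊ := Nat.one_le_floor_iff _ |>.2 hx
      have hc' : (0:ℝ) < ⌊x⌋₊ := by exact_mod_cast hc
      rw [hv' _ hc, div_mul_div_cancel₀ hc'.ne']
      have := hanti ⌊x⌋₊ x hc' (Nat.floor_le (by linarith))
      gcongr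
  have hT : Tendsto (fun ε : ℝ => ε ^ (-(1 / H))) (𝓝[>] 0) atTop :=
    tendsto_rpow_neg_nhdsGT_zero (by simpa using hH)
  refine (hreal.comp hT).congr' ?_
  filter_upwards [self_mem_nhdsWithin] with ε hε
  have hε : 0 < ε := hε
  simp only [Function.comp, hg]
  rw [← Real.rpow_mul hε.le, Real.rpow_neg hε.le, div_inv_eq_mul, mul_comm]
  congr 4
  have : -(1 / H) * -H = 1 := by field_simp
  rw [this, Real.rpow_one]

end assembly

/-- Existence of a finite positive small deviation constant for the Gaussian
Riemann–Liouville process of arbitrary Hurst parameter `H > 0` under the supremum norm: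
`lim_{ε↓0} ε^{1/H} log P[sup_{0≤t≤1} |R_t| ≤ ε] = -K` with `K ∈ (0,∞)`. -/
theorem small_deviation_RL_sup {Ω : Type*} [MeasurableSpace Ω]
    (P : Measure Ω) [IsProbabilityMeasure P]
    (H : ℝ) (hH : 0 < H) (R : ℝ → Ω → ℝ) (hR : IsGaussianRL P R H)
    (hcont : ∀ ω, ContinuousOn (fun t => R t ω) (Set.Icc 0 1)) :
    ∃ K : ℝ, 0 < K ∧
      Tendsto
        (fun ε : ℝ =>
          ε ^ (1 / H) *
            Real.log (P {ω | ∀ t ∈ Set.Icc (0:ℝ) 1, |R t ω| ≤ ε}).toReal)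
        (𝓝[>] (0:ℝ)) (𝓝 (-K)) := by
  exact hR.limit hH hcont
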